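/- Let K = Sp(p) × Sp(q) with p ≥ q ≥ 5, acting on ℍ^p ⊗_ℍ ℍ^{q*}, and let H = Sp(p−q) × Sp(1)^q be the identity component of a principal isotropy group of this action (with Sp(p−q) ⊂ Sp(p) acting on the last p−q coordinates and Sp(1)^q embedded diagonally in Sp(p) × Sp(q)). If G is a closed connected subgroup of K such that G × H acts on K with cohomogeneity at most one by left and right translations, then G = K. -/

import Mathlib

/-! Statement 11: if `K = Sp p × Sp q` (`p ≥ q ≥ 5`), `H = Sp(p-q) × Sp(1)^q` the identity
component of a principal isotropy group of the isotropy representation of the quaternionic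
Grassmannian, and `G` is a closed connected subgroup of `K` such that `G × H` acts on `K`
with cohomogeneity at most one by left and right translations, then `G = K`. -/
open Module

noncomputable section

/-- The tangent space at `x` of a set `S` of matrices: the span of all entrywise
velocities at `0` of curves in `S` passing through `x`. -/
def matTangentAt {m n R : Type*} [NormedAddCommGroup R] [NormedSpace ℝ R]
    (S : Set (Matrix m n R)) (x : Matrix m n R) : Submodule ℝ (Matrix m n R) :=
  Submodule.span ℝ {w | ∃ c : ℝ → Matrix m n R, (∀ t, c t ∈ S) ∧ c 0 = x ∧
    ∀ i j, HasDerivAt (fun t => c t i j) (w i j) 0}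

variable {n : Type*} {R : Type*} [Fintype n] [DecidableEq n] [Semiring R] [StarRing R]

/-- A set of square matrices is a subgroup (of a unitary group) if it contains `1` and is
closed under multiplication and conjugate transposition (= inversion, for unitary
matrices). -/
def IsMatSubgroup (G : Set (Matrix n n R)) : Prop :=
  (1 : Matrix n n R) ∈ G ∧ (∀ a ∈ G, ∀ b ∈ G, a * b ∈ G) ∧ ∀ a ∈ G, star a ∈ G

/-- The orbit of `k` under the action of `G × H` by left and right translations,
`(g, h) · k = g * k * h⁻¹` (for unitary matrices `h⁻¹ = star h`). -/
def lrOrbit (G H : Set (Matrix n n R)) (k : Matrix n n R) : Set (Matrix n n R) :=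
  {x | ∃ g ∈ G, ∃ h ∈ H, x = g * k * star h}

/-- The dimension of a matrix group: the dimension of its tangent space at `1`. -/
def grpDim [NormedAddCommGroup R] [NormedSpace ℝ R] (K : Set (Matrix n n R)) : ℕ :=
  finrank ℝ (matTangentAt K 1)

/-- The cohomogeneity of the action of `G × H` on `K` by left and right translations:
`dim K` minus the maximal orbit dimension. -/
def lrCohomogeneity [NormedAddCommGroup R] [NormedSpace ℝ R]
    (G H K : Set (Matrix n n R)) : ℕ :=
  grpDim K - ⨆ k : K, finrank ℝ (matTangentAt (lrOrbit G H k) (k : Matrix n n R))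

end

noncomputable section

/-- The group `Sp p × Sp q`, realized as block-diagonal quaternionic unitary matrices
indexed by `Fin p ⊕ Fin q`. -/
def SpPairSet (p q : ℕ) : Set (Matrix (Fin p ⊕ Fin q) (Fin p ⊕ Fin q) (Quaternion ℝ)) :=
  {A | star A * A = 1 ∧ A * star A = 1 ∧
    ∀ (i : Fin p) (j : Fin q), A (Sum.inl i) (Sum.inr j) = 0 ∧ A (Sum.inr j) (Sum.inl i) = 0}

/-- The subgroup `Sp(p-q) × Sp(1)^q ⊆ Sp p × Sp q`: `Sp(p-q)` acts on the last `p-q`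
coordinates of `ℍ^p`, and `Sp(1)^q` is embedded diagonally in `Sp p × Sp q` (acting
diagonally on the first `q` coordinates of `ℍ^p` and on `ℍ^q`). -/
def SpPrincipalIsotropy (p q : ℕ) (hqp : q ≤ p) :
    Set (Matrix (Fin p ⊕ Fin q) (Fin p ⊕ Fin q) (Quaternion ℝ)) :=
  {A | A ∈ SpPairSet p q ∧
    -- the first `q` rows of the `Sp p`-block are diagonal
    (∀ i : Fin p, (i : ℕ) < q → ∀ j, j ≠ Sum.inl i → A (Sum.inl i) j = 0) ∧
    -- the last `p - q` rows of the `Sp p`-block are supported on the last `p - q` columns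
    (∀ i : Fin p, q ≤ (i : ℕ) → ∀ j : Fin p, (j : ℕ) < q → A (Sum.inl i) (Sum.inl j) = 0) ∧
    -- the `Sp q`-block is diagonal
    (∀ i j : Fin q, i ≠ j → A (Sum.inr i) (Sum.inr j) = 0) ∧
    -- the two diagonal parts match (diagonal embedding of `Sp(1)^q`)
    ∀ i : Fin q, A (Sum.inr i) (Sum.inr i) =
      A (Sum.inl ⟨(i : ℕ), lt_of_lt_of_le i.isLt hqp⟩)
        (Sum.inl ⟨(i : ℕ), lt_of_lt_of_le i.isLt hqp⟩)}

end

section Lie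

set_option linter.unusedSectionVars false

open NormedSpace Filter Topology

variable {A : Type*} [NormedRing A] [NormedAlgebra ℝ A] [FiniteDimensional ℝ A] [CompleteSpace A]
  [StarRing A] [StarModule ℝ A] [ContinuousStar A]

/-- A compact group of unitary elements of a star algebra. -/
structure IsCompactUnitary (G : Set A) : Prop where
  one_mem : 1 ∈ G
  mul_mem : ∀ a ∈ G, ∀ b ∈ G, a * b ∈ G
  star_mem : ∀ a ∈ G, star a ∈ G
  star_mul_self : ∀ a ∈ G, star a * a = 1
  isCompact : IsCompact G

omit [FiniteDimensional ℝ A] [StarRing A] [StarModule ℝ A] [ContinuousStar A] in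
theorem hasDerivAt_exp_smul_zero (X : A) : HasDerivAt (fun t : ℝ => exp (t • X)) X 0 := by
  simpa using hasDerivAt_exp_smul_const (𝕂 := ℝ) X (0 : ℝ)

theorem exp_smul_add_smul (X : A) (s t : ℝ) :
    exp ((s + t) • X) = exp (s • X) * exp (t • X) := by
  let _ := NormedAlgebra.restrictScalars ℚ ℝ A
  rw [add_smul]
  exact exp_add_of_commute ((Commute.refl X).smul_left _ |>.smul_right _)

namespace IsCompactUnitary

variable {G : Set A} (hG : IsCompactUnitary G)

include hG

theorem mul_star_self {a : A} (ha : a ∈ G) : a * star a = 1 := by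
  simpa using hG.star_mul_self _ (hG.star_mem _ ha)

theorem pow_mem {a : A} (ha : a ∈ G) (N : ℕ) : a ^ N ∈ G := by
  induction N with
  | zero => simpa using hG.one_mem
  | succ N ih => rw [pow_succ]; exact hG.mul_mem _ ih _ ha

theorem exp_mem_of_tendsto {ι : Type*} {l : Filter ι} [l.NeBot] {g : ι → A} {r : ι → ℝ} {X : A}
    (hg : ∀ᶠ i in l, g i ∈ G) (hr : Tendsto r l (𝓝[>] 0))
    (hX : Tendsto (fun i => (r i)⁻¹ • (g i - 1)) l (𝓝 X)) {t : ℝ} (ht : 0 ≤ t) :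
    exp (t • X) ∈ G := by
  let _ := NormedAlgebra.restrictScalars ℚ ℝ A
  have hexp : HasStrictFDerivAt (exp : A → A)
      ((ContinuousLinearEquiv.refl ℝ A : A ≃L[ℝ] A) : A →L[ℝ] A)
      0 := hasStrictFDerivAt_exp_zero
  have hinv := hexp.eventually_right_inverse
  have hL := hexp.to_localInverse.hasFDerivAt.hasFDerivWithinAt (s := Set.univ)
  have hL1 : hexp.localInverse exp _ 0 (exp 0) = 0 := hexp.localInverse_apply_image
  rw [exp_zero] at hinv hL hL1
  have hrinv : Tendsto (fun i => (r i)⁻¹) l atTop := tendsto_inv_nhdsGT_zero.comp hr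
  have hr0 : Tendsto r l (𝓝 0) := hr.mono_right nhdsWithin_le_nhds
  have hrpos : ∀ᶠ i in l, 0 < r i := hr.eventually self_mem_nhdsWithin
  have hg1 : Tendsto g l (𝓝 1) := by
    have : Tendsto (fun i => r i • ((r i)⁻¹ • (g i - 1)) + 1) l (𝓝 ((0 : ℝ) • X + 1)) :=
      (hr0.smul hX).add_const _
    rw [zero_smul, zero_add] at this
    refine this.congr' ?_
    filter_upwards [hrpos] with i hi
    rw [smul_inv_smul₀ hi.ne']; simp
  have hlog := HasFDerivWithinAt.lim hL (l := l) (c := fun i => (r i)⁻¹) (d := fun i => g i - 1)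
    (v := X)
    (by simpa using hg1.sub_const 1) (by simp) hX
  simp only [hL1, add_sub_cancel, sub_zero] at hlog
  have hN : Tendsto (fun i => (⌊t * (r i)⁻¹⌋₊ : ℝ) / (r i)⁻¹) l (𝓝 t) :=
    (tendsto_nat_floor_mul_div_atTop ht).comp hrinv
  have hlim := hN.smul hlog
  have hlim2 := ((exp_continuous (𝔸 := A)).tendsto _).comp hlim
  refine hG.isCompact.isClosed.mem_of_tendsto hlim2 ?_
  filter_upwards [hg, hrpos, hg1.eventually hinv] with i hgi hri hi
  have : ((⌊t * (r i)⁻¹⌋₊ : ℝ) / (r i)⁻¹) • (r i)⁻¹ • hexp.localInverse exp _ 0 (g i)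
      = ⌊t * (r i)⁻¹⌋₊ • hexp.localInverse exp _ 0 (g i) := by
    rw [smul_smul, div_mul_cancel₀ _ (inv_ne_zero hri.ne'), Nat.cast_smul_eq_nsmul]
  rw [Function.comp_apply, this, exp_nsmul, hi]
  exact hG.pow_mem hgi _

theorem forall_exp_mem_of_tendsto {ι : Type*} {l : Filter ι} [l.NeBot] {g : ι → A} {r : ι → ℝ}
    {X : A} (hg : ∀ᶠ i in l, g i ∈ G) (hr : Tendsto r l (𝓝[>] 0))
    (hX : Tendsto (fun i => (r i)⁻¹ • (g i - 1)) l (𝓝 X)) (t : ℝ) :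
    exp (t • X) ∈ G := by
  rcases le_total 0 t with ht | ht
  · exact hG.exp_mem_of_tendsto hg hr hX ht
  · have h := hG.exp_mem_of_tendsto hg hr hX (neg_nonneg.2 ht)
    have h1 := hG.star_mul_self _ h
    have h2 : exp (-t • X) * exp (t • X) = 1 := by
      rw [← exp_smul_add_smul]; simp
    have h3 : exp (t • X) = star (exp (-t • X)) :=
      calc exp (t • X) = star (exp (-t • X)) * exp (-t • X) * exp (t • X) := by rw [h1, one_mul]
        _ = _ := by rw [mul_assoc, h2, mul_one]
    rw [h3]
    exact hG.star_mem _ h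

theorem forall_exp_mem_of_hasDerivAt {c : ℝ → A} {X : A} (hc : ∀ t, c t ∈ G) (h0 : c 0 = 1)
    (hX : HasDerivAt c X 0) (t : ℝ) : exp (t • X) ∈ G := by
  refine hG.forall_exp_mem_of_tendsto (l := 𝓝[>] (0 : ℝ)) (.of_forall hc) tendsto_id ?_ t
  simpa [h0] using hX.tendsto_slope_zero_right

omit hG in
/-- The Lie algebra of a compact group of unitary elements. -/
def lie (hG : IsCompactUnitary G) : Submodule ℝ A where
  carrier := {X | ∀ t : ℝ, exp (t • X) ∈ G}
  zero_mem' t := by simpa using hG.one_mem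
  add_mem' {X Y} hX hY := by
    refine hG.forall_exp_mem_of_hasDerivAt (c := fun t => exp (t • X) * exp (t • Y))
      (fun t => hG.mul_mem _ (hX t) _ (hY t)) (by simp) ?_
    simpa using! (hasDerivAt_exp_smul_zero X).mul (hasDerivAt_exp_smul_zero Y)
  smul_mem' c X hX t := by rw [smul_smul]; exact hX _

theorem exp_mem {X : A} (hX : X ∈ hG.lie) (t : ℝ) : exp (t • X) ∈ G := hX t

theorem star_eq_neg {X : A} (hX : X ∈ hG.lie) : star X = -X := by
  have h := hasDerivAt_exp_smul_zero X
  have h2 := h.star.mul h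
  have h3 : (fun t : ℝ => star (exp (t • X)) * exp (t • X)) = fun _ => 1 :=
    funext fun t => hG.star_mul_self _ (hX t)
  have h4 := h2.unique (h3 ▸ hasDerivAt_const (0 : ℝ) (1 : A))
  simp only [zero_smul, exp_zero, mul_one, star_one, one_mul] at h4
  exact eq_neg_of_add_eq_zero_left h4

theorem conj_mem {g X : A} (hg : g ∈ G) (hX : X ∈ hG.lie) : g * X * star g ∈ hG.lie := by
  refine hG.forall_exp_mem_of_hasDerivAt (c := fun t => g * exp (t • X) * star g)
      (fun t => hG.mul_mem _ (hG.mul_mem _ hg _ (hX t)) _ (hG.star_mem _ hg))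
      (by simp [hG.mul_star_self hg]) ?_
  exact ((hasDerivAt_exp_smul_zero X).const_mul g).mul_const _

theorem bracket_mem {X Y : A} (hX : X ∈ hG.lie) (hY : Y ∈ hG.lie) :
    X * Y - Y * X ∈ hG.lie := by
  have h := hasDerivAt_exp_smul_zero X
  have h1 := ((h.mul_const Y).mul h.star)
  simp only [zero_smul, exp_zero, one_mul, star_one, mul_one, hG.star_eq_neg hX] at h1
  have h2 : HasDerivAt (fun t : ℝ => exp (t • X) * Y * star (exp (t • X))) (X * Y - Y * X) 0 := by
    rw [mul_neg, ← sub_eq_add_neg] at h1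
    exact h1
  refine (hG.lie.closed_of_finiteDimensional).mem_of_tendsto h2.tendsto_slope_zero_right
    (.of_forall fun t => hG.lie.smul_mem _ (hG.lie.sub_mem (hG.conj_mem (hX _) hY) ?_))
  simpa using hY

end IsCompactUnitary

end Lie

section OrbitTangent

open NormedSpace Filter Topology

set_option linter.unusedSectionVars false

variable {A : Type*} [NormedRing A] [NormedAlgebra ℝ A] [FiniteDimensional ℝ A] [CompleteSpace A]
  [StarRing A] [StarModule ℝ A] [ContinuousStar A]

/-- A positive definite trace form on a star algebra. -/
structure IsTraceForm (τ : A →ₗ[ℝ] ℝ) : Prop where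
  mul_comm : ∀ x y, τ (x * y) = τ (y * x)
  map_star : ∀ x, τ (star x) = τ x
  nonneg : ∀ x, 0 ≤ τ (star x * x)
  eq_zero : ∀ x, τ (star x * x) = 0 → x = 0

namespace IsTraceForm

variable {τ : A →ₗ[ℝ] ℝ} (hτ : IsTraceForm τ)

include hτ

theorem eq_zero_of_skew {X : A} (hX : star X = -X) : τ X = 0 := by
  have := hτ.map_star X
  rw [hX, map_neg] at this
  linarith

theorem trace_star_sub_one_mul {g : A} (hg : star g * g = 1) :
    τ (star (g - 1) * (g - 1)) = 2 * (τ 1 - τ g) := by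
  have : star (g - 1) * (g - 1) = star g * g - star g - g + 1 := by
    rw [star_sub, star_one]; noncomm_ring
  rw [this, hg]
  simp only [map_add, map_sub, hτ.map_star]
  ring

theorem le_one {g : A} (hg : star g * g = 1) : τ g ≤ τ 1 := by
  have := hτ.nonneg (g - 1)
  rw [hτ.trace_star_sub_one_mul hg] at this
  linarith

theorem eq_one {g : A} (hg : star g * g = 1) (h : τ 1 ≤ τ g) : g = 1 := by
  refine sub_eq_zero.1 (hτ.eq_zero _ (le_antisymm ?_ (hτ.nonneg _)))
  rw [hτ.trace_star_sub_one_mul hg]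
  linarith

end IsTraceForm

theorem exists_tendsto_ultrafilter {ι E : Type*} [NormedAddCommGroup E] [ProperSpace E]
    (l : Ultrafilter ι) {f : ι → E} {C : ℝ} (hf : ∀ᶠ i in (l : Filter ι), ‖f i‖ ≤ C) :
    ∃ x, Tendsto f l (𝓝 x) := by
  obtain ⟨x, -, hx⟩ := (isCompact_closedBall (0 : E) C).ultrafilter_le_nhds (l.map f)
    (tendsto_principal.2 (by simpa using hf))
  exact ⟨x, hx⟩

variable {τ : A →ₗ[ℝ] ℝ} {G H : Set A}

theorem hasDerivAt_trace_mul_exp (τ : A →ₗ[ℝ] ℝ) (g X : A) :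
    HasDerivAt (fun θ : ℝ => τ (g * exp (θ • X))) (τ (g * X)) 0 :=
  (LinearMap.toContinuousLinearMap τ).hasFDerivAt.comp_hasDerivAt (0 : ℝ)
    ((hasDerivAt_exp_smul_zero X).const_mul g)

/-- Velocities of curves in an orbit of the left-right action come from the Lie algebras. -/
theorem exists_lie_of_hasDerivAt_orbit (hτ : IsTraceForm τ) (hG : IsCompactUnitary G)
    (hH : IsCompactUnitary H) {k : A} (hk : star k * k = 1) (hk' : k * star k = 1) {c : ℝ → A}
    {w : A} (hc : ∀ t, ∃ g ∈ G, ∃ h ∈ H, c t = g * k * star h) (h0 : c 0 = k)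
    (hw : HasDerivAt c w 0) : ∃ X ∈ hG.lie, ∃ Y ∈ hH.lie, w = X * k - k * Y := by
  have : ProperSpace A := FiniteDimensional.proper ℝ A
  have hτc : Continuous τ := τ.continuous_of_finiteDimensional
  let fib (t : ℝ) : Set (A × A) := {x | x.1 ∈ G ∧ x.2 ∈ H ∧ x.1 * k * star x.2 = c t}
  have hfibc (t : ℝ) : IsCompact (fib t) := by
    have : fib t = (G ×ˢ H) ∩ {x | x.1 * k * star x.2 = c t} := by
      ext x; simp [fib, and_assoc]
    rw [this]
    exact (hG.isCompact.prod hH.isCompact).inter_right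
      (isClosed_eq (by fun_prop) continuous_const)
  have hmax (t : ℝ) : ∃ x ∈ fib t, ∀ y ∈ fib t, τ y.1 + τ y.2 ≤ τ x.1 + τ x.2 := by
    obtain ⟨g, hg, h, hh, e⟩ := hc t
    obtain ⟨x, hx, hm⟩ := (hfibc t).exists_isMaxOn ⟨(g, h), hg, hh, e.symm⟩
      (f := fun x => τ x.1 + τ x.2) (by fun_prop)
    exact ⟨x, hx, fun y hy => hm hy⟩
  choose x hx hm using hmax
  let l : Ultrafilter ℝ := Ultrafilter.of (𝓝[>] (0 : ℝ))
  have hl : (l : Filter ℝ) ≤ 𝓝[>] 0 := Ultrafilter.of_le _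
  have hl0 : (l : Filter ℝ) ≤ 𝓝 0 := hl.trans nhdsWithin_le_nhds
  have hpos : ∀ᶠ t in (l : Filter ℝ), 0 < t := hl self_mem_nhdsWithin
  have hcl : Tendsto c l (𝓝 k) := by
    have := hw.continuousAt.tendsto
    rw [h0] at this
    exact this.mono_left hl0
  have hx1 : Tendsto x l (𝓝 (1, 1)) := by
    obtain ⟨y, hy, hxy⟩ := (hG.isCompact.prod hH.isCompact).ultrafilter_le_nhds (l.map x)
      (tendsto_principal.2 (.of_forall fun t => ⟨(hx t).1, (hx t).2.1⟩))
    have hxy : Tendsto x l (𝓝 y) := hxy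
    have hyk : y.1 * k * star y.2 = k := by
      have hcont : Continuous fun z : A × A => z.1 * k * star z.2 := by fun_prop
      have h1 := (hcont.tendsto y).comp hxy
      refine tendsto_nhds_unique (h1.congr fun t => ?_) hcl
      exact (hx t).2.2
    have hyk' : star y.1 * k * y.2 = k := by
      calc star y.1 * k * y.2 = star y.1 * (y.1 * k * star y.2) * y.2 := by rw [hyk]
        _ = (star y.1 * y.1) * k * (star y.2 * y.2) := by noncomm_ring
        _ = k := by rw [hG.star_mul_self _ hy.1, hH.star_mul_self _ hy.2]; simp
    have hcmp (t : ℝ) : τ ((x t).1 * star y.1) + τ ((x t).2 * star y.2) ≤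
        τ (x t).1 + τ (x t).2 := by
      refine hm t ((x t).1 * star y.1, (x t).2 * star y.2)
        ⟨hG.mul_mem _ (hx t).1 _ (hG.star_mem _ hy.1),
          hH.mul_mem _ (hx t).2.1 _ (hH.star_mem _ hy.2), ?_⟩
      rw [← (hx t).2.2]
      simp only [star_mul, star_star]
      calc _ = (x t).1 * (star y.1 * k * y.2) * star (x t).2 := by noncomm_ring
        _ = _ := by rw [hyk']
    have h1 : Tendsto (fun t => τ ((x t).1 * star y.1) + τ ((x t).2 * star y.2)) l
        (𝓝 (τ (y.1 * star y.1) + τ (y.2 * star y.2))) := by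
      have hcont : Continuous fun z : A × A => τ (z.1 * star y.1) + τ (z.2 * star y.2) := by
        fun_prop
      exact (hcont.tendsto y).comp hxy
    have h2 : Tendsto (fun t => τ (x t).1 + τ (x t).2) l (𝓝 (τ y.1 + τ y.2)) := by
      have hcont : Continuous fun z : A × A => τ z.1 + τ z.2 := by fun_prop
      exact (hcont.tendsto y).comp hxy
    have h3 := le_of_tendsto_of_tendsto' h1 h2 hcmp
    rw [hG.mul_star_self hy.1, hH.mul_star_self hy.2] at h3
    have h4 := hG.star_mul_self _ hy.1
    have h5 := hH.star_mul_self _ hy.2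
    have h6 := hτ.le_one h4
    have h7 := hτ.le_one h5
    have : y = (1, 1) := Prod.ext (hτ.eq_one h4 (by linarith)) (hτ.eq_one h5 (by linarith))
    rwa [this] at hxy
  have hx11 : Tendsto (fun t => (x t).1 - 1) l (𝓝 0) := by
    simpa using ((continuous_fst.tendsto _).comp hx1).sub_const 1
  have hx21 : Tendsto (fun t => (x t).2 - 1) l (𝓝 0) := by
    simpa using ((continuous_snd.tendsto _).comp hx1).sub_const 1
  let ρ (t : ℝ) : ℝ := ‖(x t).1 - 1‖ + ‖(x t).2 - 1‖ + t
  have hρpos : ∀ᶠ t in (l : Filter ℝ), 0 < ρ t := hpos.mono fun t ht => by positivity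
  have hρ0 : Tendsto ρ l (𝓝 0) := by
    simpa using (hx11.norm.add hx21.norm).add (tendsto_id.mono_left hl0)
  have hρ : Tendsto ρ l (𝓝[>] 0) :=
    tendsto_nhdsWithin_iff.2 ⟨hρ0, hρpos⟩
  obtain ⟨X, hX⟩ := exists_tendsto_ultrafilter l (f := fun t => (ρ t)⁻¹ • ((x t).1 - 1))
    (C := 1) <| by
    filter_upwards [hpos, hρpos] with t ht hρt
    rw [norm_smul, norm_inv, Real.norm_of_nonneg hρt.le, inv_mul_le_one₀ hρt]
    linarith [norm_nonneg ((x t).2 - 1)]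
  obtain ⟨Y, hY⟩ := exists_tendsto_ultrafilter l (f := fun t => (ρ t)⁻¹ • ((x t).2 - 1))
    (C := 1) <| by
    filter_upwards [hpos, hρpos] with t ht hρt
    rw [norm_smul, norm_inv, Real.norm_of_nonneg hρt.le, inv_mul_le_one₀ hρt]
    linarith [norm_nonneg ((x t).1 - 1)]
  obtain ⟨s, hs⟩ := exists_tendsto_ultrafilter l (f := fun t => (ρ t)⁻¹ * t) (C := 1) <| by
    filter_upwards [hpos, hρpos] with t ht hρt
    rw [norm_mul, norm_inv, Real.norm_of_nonneg hρt.le, inv_mul_le_one₀ hρt,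
      Real.norm_of_nonneg ht.le]
    linarith [norm_nonneg ((x t).1 - 1), norm_nonneg ((x t).2 - 1)]
  have hXm : X ∈ hG.lie := hG.forall_exp_mem_of_tendsto (.of_forall fun t => (hx t).1) hρ hX
  have hYm : Y ∈ hH.lie := hH.forall_exp_mem_of_tendsto (.of_forall fun t => (hx t).2.1) hρ hY
  have hsum : ‖X‖ + ‖Y‖ + s = 1 := by
    refine tendsto_nhds_unique ((hX.norm.add hY.norm).add hs) (tendsto_const_nhds.congr' ?_)
    filter_upwards [hρpos] with t hρt
    rw [norm_smul, norm_smul, norm_inv, Real.norm_of_nonneg hρt.le, ← mul_add, ← mul_add,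
      inv_mul_cancel₀ hρt.ne']
  have hsw : s • w = X * k - k * Y := by
    have h1 : Tendsto (fun t => ((ρ t)⁻¹ * t) • (t⁻¹ • (c t - k))) l (𝓝 (s • w)) := by
      refine hs.smul ?_
      have := hw.tendsto_slope_zero_right
      simp only [zero_add, h0] at this
      exact this.mono_left hl
    refine tendsto_nhds_unique h1 ?_
    refine ((hX.mul_const k).sub (hcl.mul hY)).congr' ?_
    filter_upwards [hpos] with t ht
    have h2 : c t * (x t).2 = (x t).1 * k := by
      rw [← (hx t).2.2, mul_assoc, hH.star_mul_self _ (hx t).2.1, mul_one]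
    rw [smul_smul, mul_assoc, mul_inv_cancel₀ ht.ne', mul_one, smul_mul_assoc, mul_smul_comm,
      ← smul_sub, mul_sub, sub_mul, h2]
    congr 1
    noncomm_ring
  by_cases hs0 : s = 0
  · exfalso
    rw [hs0, zero_smul] at hsw
    have hXY : X = k * Y * star k := by
      rw [← sub_eq_zero.1 hsw.symm, mul_assoc, hk', mul_one]
    let _ := NormedAlgebra.restrictScalars ℚ ℝ A
    have hexp (θ : ℝ) : exp (θ • X) * k = k * exp (θ • Y) := by
      let u : Aˣ := ⟨k, star k, hk', hk⟩
      have h1 : exp (k * (θ • Y) * star k) = k * exp (θ • Y) * star k := exp_units_conj u (θ • Y)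
      rw [hXY, ← smul_mul_assoc, ← mul_smul_comm, h1, mul_assoc, hk, mul_one]
    have hder (t : ℝ) : τ ((x t).1 * X) + τ ((x t).2 * Y) = 0 := by
      have h1 := (hasDerivAt_trace_mul_exp τ (x t).1 X).add (hasDerivAt_trace_mul_exp τ (x t).2 Y)
      refine IsLocalMax.hasDerivAt_eq_zero (.of_forall fun θ => ?_) h1
      simp only [Pi.add_apply, zero_smul, exp_zero, mul_one]
      refine hm t ((x t).1 * exp (θ • X), (x t).2 * exp (θ • Y))
        ⟨hG.mul_mem _ (hx t).1 _ (hXm θ), hH.mul_mem _ (hx t).2.1 _ (hYm θ), ?_⟩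
      simp only [star_mul]
      rw [mul_assoc (x t).1, hexp]
      calc _ = (x t).1 * k * (exp (θ • Y) * star (exp (θ • Y))) * star (x t).2 := by noncomm_ring
        _ = _ := by rw [hH.mul_star_self (hYm θ), mul_one, (hx t).2.2]
    have hXs := hG.star_eq_neg hXm
    have hYs := hH.star_eq_neg hYm
    have hlim : τ (X * X) + τ (Y * Y) = 0 := by
      have hcont : Continuous fun z : A × A => τ (z.1 * X) + τ (z.2 * Y) := by fun_prop
      have h1 := (hcont.tendsto (X, Y)).comp (hX.prodMk_nhds hY)
      refine tendsto_nhds_unique h1 (tendsto_const_nhds.congr fun t => ?_)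
      have h2 := hder t
      simp only [Function.comp_apply, smul_mul_assoc, sub_mul, one_mul, map_smul, map_sub,
        hτ.eq_zero_of_skew hXs, hτ.eq_zero_of_skew hYs, sub_zero, ← smul_add, h2, smul_zero]
    have hXX := hτ.nonneg X
    have hYY := hτ.nonneg Y
    simp only [hXs, hYs, neg_mul, map_neg] at hXX hYY
    have hX0 : X = 0 := hτ.eq_zero X (by rw [hXs, neg_mul, map_neg]; linarith)
    have hY0 : Y = 0 := hτ.eq_zero Y (by rw [hYs, neg_mul, map_neg]; linarith)
    simp [hX0, hY0, hs0] at hsum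
  · refine ⟨s⁻¹ • X, hG.lie.smul_mem _ hXm, s⁻¹ • Y, hH.lie.smul_mem _ hYm, ?_⟩
    rw [smul_mul_assoc, mul_smul_comm, ← smul_sub, ← hsw, inv_smul_smul₀ hs0]

end OrbitTangent

section OpenOrbit

open NormedSpace Filter Topology
open scoped Pointwise

set_option linter.unusedSectionVars false

variable {A : Type*} [NormedRing A] [NormedAlgebra ℝ A] [FiniteDimensional ℝ A] [CompleteSpace A]
  [StarRing A] [StarModule ℝ A] [ContinuousStar A]

theorem star_exp_smul {X : A} (hX : star X = -X) (t : ℝ) :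
    star (exp (t • X)) = exp ((-t) • X) := by
  let _ := NormedAlgebra.restrictScalars ℚ ℝ A
  rw [star_exp, star_smul, hX, star_trivial, smul_neg, neg_smul]

theorem star_exp_smul_mul_self {X : A} (hX : star X = -X) (t : ℝ) :
    star (exp (t • X)) * exp (t • X) = 1 := by
  rw [star_exp_smul hX, ← exp_smul_add_smul]; simp

theorem exp_smul_mul_star_self {X : A} (hX : star X = -X) (t : ℝ) :
    exp (t • X) * star (exp (t • X)) = 1 := by
  rw [star_exp_smul hX, ← exp_smul_add_smul]; simp

theorem continuous_exp_smul (X : A) : Continuous fun t : ℝ => exp (t • X) := by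
  let _ := NormedAlgebra.restrictScalars ℚ ℝ A
  have := exp_continuous (𝔸 := A)
  fun_prop

variable {G H : Set A}

theorem eventually_unitary_mem_mul (hG : IsCompactUnitary G) (hH : IsCompactUnitary H)
    (h : ∀ X : A, star X = -X → X ∈ hG.lie ⊔ hH.lie) :
    ∀ᶠ U in 𝓝 (1 : A), star U * U = 1 → U ∈ G * H := by
  let _ := NormedAlgebra.restrictScalars ℚ ℝ A
  let P : Submodule ℝ A :=
    { carrier := {S | star S = S}
      zero_mem' := star_zero A
      add_mem' := fun {x y} hx hy => by
        have hx : star x = x := hx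
        have hy : star y = y := hy
        change star (x + y) = x + y
        rw [star_add, hx, hy]
      smul_mem' := fun c x hx => by
        have hx : star x = x := hx
        change star (c • x) = c • x
        rw [star_smul, hx, star_trivial] }
  have hmemP (x : A) : x ∈ P ↔ star x = x := Iff.rfl
  let F : hG.lie × hH.lie × P → A := fun x => exp (x.1 : A) * exp (x.2.1 : A) * (1 + (x.2.2 : A))
  have hcomp (E : Type _) [NormedAddCommGroup E] [NormedSpace ℝ E] (f : E →L[ℝ] A) :
      HasStrictFDerivAt (fun x => exp (f x)) f 0 := by
    have h0 : HasStrictFDerivAt (exp : A → A) (ContinuousLinearMap.id ℝ A) (f 0) := by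
      rw [map_zero]; exact hasStrictFDerivAt_exp_zero
    simpa using! h0.comp (0 : E) f.hasStrictFDerivAt
  let f1 : (hG.lie × hH.lie × P) →L[ℝ] A :=
    hG.lie.subtypeL.comp (ContinuousLinearMap.fst ℝ _ _)
  let f2 : (hG.lie × hH.lie × P) →L[ℝ] A :=
    hH.lie.subtypeL.comp ((ContinuousLinearMap.fst ℝ _ _).comp (ContinuousLinearMap.snd ℝ _ _))
  let f3 : (hG.lie × hH.lie × P) →L[ℝ] A :=
    P.subtypeL.comp ((ContinuousLinearMap.snd ℝ _ _).comp (ContinuousLinearMap.snd ℝ _ _))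
  have hF : HasStrictFDerivAt F (f1 + f2 + f3) 0 := by
    have h1 := ((hcomp _ f1).mul' (hcomp _ f2)).mul' (f3.hasStrictFDerivAt.const_add (1 : A))
    refine h1.congr_fderiv ?_
    ext x
    all_goals
      simp
      abel
  have hsurj : (f1 + f2 + f3).range = ⊤ := by
    rw [LinearMap.range_eq_top]
    intro Z
    have hskew : star ((2 : ℝ)⁻¹ • (Z - star Z)) = -((2 : ℝ)⁻¹ • (Z - star Z)) := by
      rw [star_smul, star_sub, star_star, star_trivial, ← smul_neg, neg_sub]
    have hherm : (2 : ℝ)⁻¹ • (Z + star Z) ∈ P := by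
      rw [hmemP, star_smul, star_add, star_star, star_trivial, add_comm]
    obtain ⟨X, hX, Y, hY, hXY⟩ := Submodule.mem_sup.1 (h _ hskew)
    refine ⟨(⟨X, hX⟩, ⟨Y, hY⟩, ⟨_, hherm⟩), ?_⟩
    change X + Y + (2 : ℝ)⁻¹ • (Z + star Z) = Z
    rw [hXY, ← smul_add, sub_add_add_cancel, ← two_smul ℝ Z, inv_smul_smul₀ two_ne_zero]
  have hmap := hF.map_nhds_eq_of_surj hsurj
  have hF0 : F 0 = 1 := by simp [F]
  rw [hF0] at hmap
  rw [← hmap, eventually_map]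
  have hsmall : ∀ᶠ x in 𝓝 (0 : hG.lie × hH.lie × P), ‖(x.2.2 : A)‖ < 2 := by
    have : Continuous fun x : hG.lie × hH.lie × P => ‖(x.2.2 : A)‖ := by fun_prop
    exact this.tendsto 0 |>.eventually (gt_mem_nhds (by simp))
  filter_upwards [hsmall] with x hx hU
  have hgx : exp (x.1 : A) ∈ G := by simpa using hG.exp_mem x.1.2 1
  have hhx : exp (x.2.1 : A) ∈ H := by simpa using hH.exp_mem x.2.1.2 1
  have hS : star (x.2.2 : A) = x.2.2 := x.2.2.2
  have hsq : (1 + (x.2.2 : A)) * (1 + (x.2.2 : A)) = 1 := by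
    have : star (F x) * F x = star (1 + (x.2.2 : A)) * (star (exp (x.2.1 : A)) *
        (star (exp (x.1 : A)) * exp (x.1 : A)) * exp (x.2.1 : A)) * (1 + (x.2.2 : A)) := by
      simp only [F, star_mul]; noncomm_ring
    rw [hU, hG.star_mul_self _ hgx, mul_one, hH.star_mul_self _ hhx, mul_one, star_add,
      star_one, hS] at this
    exact this.symm
  have hS0 : (x.2.2 : A) = 0 := by
    generalize (x.2.2 : A) = S at hx hS hsq
    have h1 : (2 : ℝ) • S = -(S * S) := by
      have : (1 + S) * (1 + S) = 1 + (2 : ℝ) • S + S * S := by rw [two_smul]; noncomm_ring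
      rw [this, add_assoc] at hsq
      exact eq_neg_of_add_eq_zero_left (by simpa using hsq)
    have h2 : 2 * ‖S‖ ≤ ‖S‖ * ‖S‖ := by
      have := norm_mul_le S S
      rw [← norm_neg (S * S), ← h1, norm_smul] at this
      simpa using this
    by_contra hne
    have := norm_pos_iff.2 hne
    nlinarith
  refine Set.mem_mul.2 ⟨_, hgx, _, hhx, ?_⟩
  simp [F, hS0]

theorem mul_exp_mem_mul (hG : IsCompactUnitary G) (hH : IsCompactUnitary H)
    (h : ∀ X : A, star X = -X → X ∈ hG.lie ⊔ hH.lie) {s : A} (hs : s ∈ G * H) {X : A}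
    (hX : star X = -X) (t : ℝ) : s * exp (t • X) ∈ G * H := by
  have hcont : Continuous fun t : ℝ => s * exp (t • X) :=
    continuous_const.mul (continuous_exp_smul X)
  have hclosed : IsClosed {t : ℝ | s * exp (t • X) ∈ G * H} :=
    (hG.isCompact.mul hH.isCompact).isClosed.preimage hcont
  have hopen : IsOpen {t : ℝ | s * exp (t • X) ∈ G * H} := by
    rw [isOpen_iff_eventually]
    intro t₀ ht₀
    obtain ⟨a, ha, b, hb, hab⟩ := Set.mem_mul.1 ht₀
    have hc : Continuous fun t : ℝ => star a * (s * exp (t • X)) * star b := by fun_prop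
    have h1 : star a * (s * exp (t₀ • X)) * star b = 1 := by
      rw [← hab, ← mul_assoc, hG.star_mul_self _ ha, one_mul, hH.mul_star_self hb]
    have hlim := hc.tendsto t₀
    simp only [h1] at hlim
    filter_upwards [hlim.eventually (eventually_unitary_mem_mul hG hH h)] with t ht
    have hst : star s * s = 1 := by
      obtain ⟨c, hcG, d, hd, rfl⟩ := Set.mem_mul.1 hs
      calc star (c * d) * (c * d) = star d * (star c * c) * d := by
            rw [star_mul]; noncomm_ring
        _ = 1 := by rw [hG.star_mul_self _ hcG, mul_one, hH.star_mul_self _ hd]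
    obtain ⟨c, hc, d, hd, hcd⟩ := Set.mem_mul.1 <| ht <| by
      simp only [star_mul, star_star]
      calc b * (star (exp (t • X)) * star s * a) * (star a * (s * exp (t • X)) * star b)
          = b * (star (exp (t • X)) * (star s * (a * star a) * s) * exp (t • X)) * star b := by
            noncomm_ring
        _ = 1 := by
          rw [hG.mul_star_self ha, mul_one, hst, mul_one, star_exp_smul_mul_self hX, mul_one,
            hH.mul_star_self hb]
    refine Set.mem_mul.2 ⟨a * c, hG.mul_mem _ ha _ hc, d * b, hH.mul_mem _ hd _ hb, ?_⟩
    calc a * c * (d * b) = a * (c * d) * b := by noncomm_ring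
      _ = (a * star a) * (s * exp (t • X)) * (star b * b) := by rw [hcd]; noncomm_ring
      _ = s * exp (t • X) := by rw [hG.mul_star_self ha, hH.star_mul_self _ hb, mul_one, one_mul]
  have huniv := IsClopen.eq_univ ⟨hclosed, hopen⟩ ⟨0, by simpa using hs⟩
  exact huniv.ge (Set.mem_univ t)

end OpenOrbit

section QuaternionicVectors

open Quaternion Matrix

set_option linter.unusedSectionVars false

variable {n : Type*} [Fintype n] [DecidableEq n]

/-- The quaternion unit `i`. -/
def qi : ℍ[ℝ] := ⟨0, 1, 0, 0⟩

/-- The quaternion unit `j`. -/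
def qj : ℍ[ℝ] := ⟨0, 0, 1, 0⟩

/-- The quaternion unit `k`. -/
def qk : ℍ[ℝ] := ⟨0, 0, 0, 1⟩

@[simp] theorem qi_re : qi.re = 0 := rfl
@[simp] theorem qi_imI : qi.imI = 1 := rfl
@[simp] theorem qi_imJ : qi.imJ = 0 := rfl
@[simp] theorem qi_imK : qi.imK = 0 := rfl
@[simp] theorem qj_re : qj.re = 0 := rfl
@[simp] theorem qj_imI : qj.imI = 0 := rfl
@[simp] theorem qj_imJ : qj.imJ = 1 := rfl
@[simp] theorem qj_imK : qj.imK = 0 := rfl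
@[simp] theorem qk_re : qk.re = 0 := rfl
@[simp] theorem qk_imI : qk.imI = 0 := rfl
@[simp] theorem qk_imJ : qk.imJ = 0 := rfl
@[simp] theorem qk_imK : qk.imK = 1 := rfl

theorem qi_mul_qi : qi * qi = -1 := by ext <;> simp

theorem qj_mul_qj : qj * qj = -1 := by ext <;> simp

theorem star_qi : star qi = -qi := by ext <;> simp

theorem star_qj : star qj = -qj := by ext <;> simp

theorem star_qk : star qk = -qk := by ext <;> simp

/-- The quaternionic Hermitian product `v* u`. -/
noncomputable def qdot (v u : n → ℍ[ℝ]) : ℍ[ℝ] := ∑ i, star (v i) * u i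

/-- Right multiplication of a vector by a quaternion. -/
noncomputable def rsmul (u : n → ℍ[ℝ]) (c : ℍ[ℝ]) : n → ℍ[ℝ] := fun i => u i * c

/-- The matrix `u a v*`. -/
noncomputable def rk (u : n → ℍ[ℝ]) (a : ℍ[ℝ]) (v : n → ℍ[ℝ]) : Matrix n n ℍ[ℝ] :=
  Matrix.of fun i j => u i * a * star (v j)

omit [DecidableEq n] in
theorem star_qdot (v u : n → ℍ[ℝ]) : star (qdot v u) = qdot u v := by
  simp [qdot]

theorem qdot_add (v u w : n → ℍ[ℝ]) : qdot v (u + w) = qdot v u + qdot v w := by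
  simp [qdot, mul_add, Finset.sum_add_distrib]

theorem add_qdot (v u w : n → ℍ[ℝ]) : qdot (v + u) w = qdot v w + qdot u w := by
  simp [qdot, add_mul, Finset.sum_add_distrib]

theorem qdot_neg (v u : n → ℍ[ℝ]) : qdot v (-u) = -qdot v u := by
  simp [qdot]

theorem neg_qdot (v u : n → ℍ[ℝ]) : qdot (-v) u = -qdot v u := by
  simp [qdot]

theorem qdot_sub (v u w : n → ℍ[ℝ]) : qdot v (u - w) = qdot v u - qdot v w := by
  rw [sub_eq_add_neg, qdot_add, qdot_neg, sub_eq_add_neg]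

theorem sub_qdot (v u w : n → ℍ[ℝ]) : qdot (v - u) w = qdot v w - qdot u w := by
  rw [sub_eq_add_neg, add_qdot, neg_qdot, sub_eq_add_neg]

theorem qdot_zero (v : n → ℍ[ℝ]) : qdot v 0 = 0 := by simp [qdot]

theorem zero_qdot (v : n → ℍ[ℝ]) : qdot 0 v = 0 := by simp [qdot]

theorem qdot_smul (r : ℝ) (v u : n → ℍ[ℝ]) : qdot v (r • u) = r • qdot v u := by
  simp [qdot, Finset.smul_sum]

theorem smul_qdot (r : ℝ) (v u : n → ℍ[ℝ]) : qdot (r • v) u = r • qdot v u := by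
  simp [qdot, Finset.smul_sum]

theorem qdot_rsmul (v u : n → ℍ[ℝ]) (c : ℍ[ℝ]) : qdot v (rsmul u c) = qdot v u * c := by
  simp [qdot, rsmul, Finset.sum_mul, mul_assoc]

theorem rsmul_qdot (v u : n → ℍ[ℝ]) (c : ℍ[ℝ]) : qdot (rsmul v c) u = star c * qdot v u := by
  simp [qdot, rsmul, Finset.mul_sum, mul_assoc]

theorem qdot_comm_eq_zero {v u : n → ℍ[ℝ]} (h : qdot v u = 0) : qdot u v = 0 := by
  rw [← star_qdot, h, star_zero]

theorem qdot_mulVec (v u : n → ℍ[ℝ]) (X : Matrix n n ℍ[ℝ]) :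
    qdot v (X *ᵥ u) = qdot (star X *ᵥ v) u := by
  simp only [qdot, mulVec, dotProduct, Finset.mul_sum, star_sum, Finset.sum_mul, star_mul,
    Matrix.star_apply, star_star]
  rw [Finset.sum_comm]
  simp [mul_assoc]

theorem mulVec_rsmul (X : Matrix n n ℍ[ℝ]) (u : n → ℍ[ℝ]) (c : ℍ[ℝ]) :
    X *ᵥ rsmul u c = rsmul (X *ᵥ u) c := by
  ext1 i
  simp [rsmul, mulVec, dotProduct, Finset.sum_mul, mul_assoc]

theorem rsmul_rsmul (u : n → ℍ[ℝ]) (c d : ℍ[ℝ]) : rsmul (rsmul u c) d = rsmul u (c * d) := by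
  ext1 i; simp [rsmul, mul_assoc]

theorem rsmul_add (u : n → ℍ[ℝ]) (c d : ℍ[ℝ]) : rsmul u (c + d) = rsmul u c + rsmul u d := by
  ext1 i; simp [rsmul, mul_add]

theorem rsmul_sub (u : n → ℍ[ℝ]) (c d : ℍ[ℝ]) : rsmul u (c - d) = rsmul u c - rsmul u d := by
  ext1 i; simp [rsmul, mul_sub]

theorem rsmul_neg (u : n → ℍ[ℝ]) (c : ℍ[ℝ]) : rsmul u (-c) = -rsmul u c := by
  ext1 i; simp [rsmul]

theorem add_rsmul (u v : n → ℍ[ℝ]) (c : ℍ[ℝ]) : rsmul (u + v) c = rsmul u c + rsmul v c := by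
  ext1 i; simp [rsmul, add_mul]

theorem sub_rsmul (u v : n → ℍ[ℝ]) (c : ℍ[ℝ]) : rsmul (u - v) c = rsmul u c - rsmul v c := by
  ext1 i; simp [rsmul, sub_mul]

theorem smul_rsmul (r : ℝ) (v : n → ℍ[ℝ]) (c : ℍ[ℝ]) : rsmul (r • v) c = r • rsmul v c := by
  ext1 i; simp [rsmul]

theorem rsmul_smul (r : ℝ) (v : n → ℍ[ℝ]) (c : ℍ[ℝ]) : rsmul v (r • c) = r • rsmul v c := by
  ext1 i; simp [rsmul]

@[simp] theorem rsmul_zero (u : n → ℍ[ℝ]) : rsmul u 0 = 0 := by ext1 i; simp [rsmul]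

@[simp] theorem zero_rsmul (c : ℍ[ℝ]) : rsmul (0 : n → ℍ[ℝ]) c = 0 := by ext1 i; simp [rsmul]

@[simp] theorem rsmul_one (u : n → ℍ[ℝ]) : rsmul u 1 = u := by ext1 i; simp [rsmul]

theorem rk_mul_rk (u v u' v' : n → ℍ[ℝ]) (a b : ℍ[ℝ]) :
    rk u a v * rk u' b v' = rk u (a * qdot v u' * b) v' := by
  ext1 i j
  simp [rk, Matrix.mul_apply, qdot, Finset.mul_sum, Finset.sum_mul, mul_assoc]

theorem mul_rk (X : Matrix n n ℍ[ℝ]) (u v : n → ℍ[ℝ]) (a : ℍ[ℝ]) :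
    X * rk u a v = rk (X *ᵥ u) a v := by
  ext1 i j
  simp [rk, Matrix.mul_apply, mulVec, dotProduct, Finset.sum_mul, mul_assoc]

theorem rk_mul (X : Matrix n n ℍ[ℝ]) (u v : n → ℍ[ℝ]) (a : ℍ[ℝ]) :
    rk u a v * X = rk u a (star X *ᵥ v) := by
  ext1 i j
  simp [rk, Matrix.mul_apply, mulVec, dotProduct, Finset.mul_sum, mul_assoc]

theorem star_rk (u v : n → ℍ[ℝ]) (a : ℍ[ℝ]) : star (rk u a v) = rk v (star a) u := by
  ext1 i j
  simp [rk, Matrix.star_apply, mul_assoc]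

theorem rk_mulVec (u v w : n → ℍ[ℝ]) (a : ℍ[ℝ]) : rk u a v *ᵥ w = rsmul u (a * qdot v w) := by
  ext1 i
  simp [rk, mulVec, dotProduct, rsmul, qdot, Finset.mul_sum, mul_assoc]

theorem rk_rsmul (u v : n → ℍ[ℝ]) (a c : ℍ[ℝ]) : rk u a (rsmul v c) = rk u (a * star c) v := by
  ext1 i j; simp [rk, rsmul, mul_assoc]

theorem rsmul_rk (u v : n → ℍ[ℝ]) (a c : ℍ[ℝ]) : rk (rsmul u c) a v = rk u (c * a) v := by
  ext1 i j; simp [rk, rsmul, mul_assoc]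

theorem rk_add (u v : n → ℍ[ℝ]) (a b : ℍ[ℝ]) : rk u (a + b) v = rk u a v + rk u b v := by
  ext1 i j; simp [rk, mul_add, add_mul]

theorem rk_sub (u v : n → ℍ[ℝ]) (a b : ℍ[ℝ]) : rk u (a - b) v = rk u a v - rk u b v := by
  ext1 i j; simp [rk, mul_sub, sub_mul]

theorem rk_neg (u v : n → ℍ[ℝ]) (a : ℍ[ℝ]) : rk u (-a) v = -rk u a v := by
  ext1 i j; simp [rk]

theorem rk_smul (r : ℝ) (u v : n → ℍ[ℝ]) (a : ℍ[ℝ]) : rk u (r • a) v = r • rk u a v := by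
  ext1 i j; simp [rk]

theorem smul_rk (r : ℝ) (u v : n → ℍ[ℝ]) (a : ℍ[ℝ]) : rk (r • u) a v = r • rk u a v := by
  ext1 i j; simp [rk]

theorem rk_smul_right (r : ℝ) (u v : n → ℍ[ℝ]) (a : ℍ[ℝ]) : rk u a (r • v) = r • rk u a v := by
  ext1 i j; simp [rk]

theorem add_rk (u w v : n → ℍ[ℝ]) (a : ℍ[ℝ]) : rk (u + w) a v = rk u a v + rk w a v := by
  ext1 i j; simp [rk, add_mul]

theorem rk_add_right (u v w : n → ℍ[ℝ]) (a : ℍ[ℝ]) : rk u a (v + w) = rk u a v + rk u a w := by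
  ext1 i j; simp [rk, mul_add]

@[simp] theorem rk_zero (u v : n → ℍ[ℝ]) : rk u 0 v = 0 := by ext1 i j; simp [rk]

@[simp] theorem zero_rk (v : n → ℍ[ℝ]) (a : ℍ[ℝ]) : rk 0 a v = 0 := by ext1 i j; simp [rk]

@[simp] theorem rk_zero_right (v : n → ℍ[ℝ]) (a : ℍ[ℝ]) : rk v a 0 = 0 := by ext1 i j; simp [rk]

/-- The squared norm of a vector. -/
noncomputable def nsq (u : n → ℍ[ℝ]) : ℝ := ∑ i, normSq (u i)

theorem qdot_self (u : n → ℍ[ℝ]) : qdot u u = (nsq u : ℍ[ℝ]) := by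
  simp only [qdot, nsq, Quaternion.star_mul_self]
  exact (map_sum (algebraMap ℝ ℍ[ℝ]) _ _).symm

theorem nsq_nonneg (u : n → ℍ[ℝ]) : 0 ≤ nsq u := Finset.sum_nonneg fun _ _ => normSq_nonneg

theorem nsq_eq_zero {u : n → ℍ[ℝ]} : nsq u = 0 ↔ u = 0 := by
  rw [nsq, Finset.sum_eq_zero_iff_of_nonneg fun _ _ => normSq_nonneg]
  simp [funext_iff]

theorem qdot_self_eq_zero {u : n → ℍ[ℝ]} : qdot u u = 0 ↔ u = 0 := by
  rw [qdot_self, ← nsq_eq_zero]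
  exact Quaternion.coe_injective.eq_iff' rfl

theorem nsq_pos {u : n → ℍ[ℝ]} (hu : u ≠ 0) : 0 < nsq u :=
  lt_of_le_of_ne (nsq_nonneg u) fun h => hu (nsq_eq_zero.1 h.symm)

/-- Every nonzero vector is a positive multiple of a unit vector. -/
theorem exists_unit_smul {u : n → ℍ[ℝ]} (hu : u ≠ 0) :
    ∃ (r : ℝ) (v : n → ℍ[ℝ]), 0 < r ∧ qdot v v = 1 ∧ u = r • v := by
  have h := nsq_pos hu
  have hs := Real.sqrt_pos.2 h
  refine ⟨√(nsq u), (√(nsq u))⁻¹ • u, hs, ?_, (smul_inv_smul₀ hs.ne' u).symm⟩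
  rw [qdot_smul, smul_qdot, qdot_self, smul_smul, ← mul_inv, Real.mul_self_sqrt h.le,
    ← Quaternion.coe_smul, smul_eq_mul, inv_mul_cancel₀ h.ne', Quaternion.coe_one]

theorem mulVec_single_eq (X : Matrix n n ℍ[ℝ]) (j : n) :
    X *ᵥ (Pi.single j 1) = fun i => X i j := by
  ext1 i; simp [mulVec, dotProduct, Pi.single_apply]

theorem qdot_single (i : n) (u : n → ℍ[ℝ]) : qdot (Pi.single i 1) u = u i := by
  simp [qdot, Pi.single_apply, apply_ite star]

theorem sum_rk_single (X : Matrix n n ℍ[ℝ]) :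
    X = ∑ i, ∑ j, rk (Pi.single i 1) (X i j) (Pi.single j 1) := by
  ext1 k l
  simp [Matrix.sum_apply, rk, Pi.single_apply, apply_ite star, Finset.sum_ite_eq]

theorem ext_mulVec {X Y : Matrix n n ℍ[ℝ]} (h : ∀ u, X *ᵥ u = Y *ᵥ u) : X = Y := by
  ext1 i j
  simpa [mulVec_single_eq] using congrFun (h (Pi.single j 1)) i

theorem star_real_smul (r : ℝ) (X : Matrix n n ℍ[ℝ]) : star (r • X) = r • star X := by
  ext1 i j; simp [Matrix.star_apply]

/-- Skew-Hermitian matrices lie in every subspace containing all `f a f*` with `f` a unit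
vector and `a` imaginary. -/
theorem skew_mem_of_rk_mem {S : Submodule ℝ (Matrix n n ℍ[ℝ])}
    (hS : ∀ f, qdot f f = 1 → ∀ a, star a = -a → rk f a f ∈ S) {X : Matrix n n ℍ[ℝ]}
    (hX : star X = -X) : X ∈ S := by
  have h1 (f : n → ℍ[ℝ]) (a : ℍ[ℝ]) (ha : star a = -a) : rk f a f ∈ S := by
    by_cases hf : f = 0
    · simp [hf]
    · obtain ⟨r, v, -, hv, rfl⟩ := exists_unit_smul hf
      rw [smul_rk, rk_smul_right]
      exact S.smul_mem _ (S.smul_mem _ (hS v hv a ha))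
  have h2 (u v : n → ℍ[ℝ]) (c : ℍ[ℝ]) : rk u c v - rk v (star c) u ∈ S := by
    obtain ⟨a, haa, ha⟩ : ∃ a : ℍ[ℝ], a * a = -1 ∧ star a = -a := ⟨qi, qi_mul_qi, star_qi⟩
    have hb : star (star c * a) = -(a * c) := by simp [ha]
    have h3 := h1 (u + rsmul v (star c * a)) a ha
    rw [add_rk, rk_add_right, rk_add_right, rk_rsmul, rk_rsmul, rsmul_rk, hb, rsmul_rk,
      mul_neg, ← mul_assoc, haa, mul_assoc, haa] at h3
    have h4 := h1 u a ha
    have h5 := h1 v (star c * a * (a * -(a * c))) (by simp [ha, mul_assoc])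
    have h6 := S.sub_mem (S.sub_mem h3 h4) h5
    simp only [mul_neg, neg_neg, neg_mul, one_mul, mul_one, rk_neg] at h6 ⊢
    convert h6 using 1
    simp [← mul_assoc, haa, rk_neg]
    abel
  have h3 : X = ∑ i, ∑ j, (2 : ℝ)⁻¹ • (rk (Pi.single i 1) (X i j) (Pi.single j 1) -
      rk (Pi.single j 1) (star (X i j)) (Pi.single i 1)) := by
    have h4 : X = (2 : ℝ)⁻¹ • (X - star X) := by
      rw [hX, sub_neg_eq_add, ← two_smul ℝ X, inv_smul_smul₀ two_ne_zero]
    conv_lhs => rw [h4]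
    conv_lhs => enter [2]; rw [sum_rk_single X]
    simp only [star_sum, star_rk, Finset.smul_sum, smul_sub, Finset.sum_sub_distrib]
  rw [h3]
  exact S.sum_mem fun i _ => S.sum_mem fun j _ => S.smul_mem _ (h2 _ _ _)

/-- Quaternionic unitary matrices. -/
def SpSet (n : Type*) [Fintype n] [DecidableEq n] : Set (Matrix n n ℍ[ℝ]) :=
  {U | star U * U = 1 ∧ U * star U = 1}

theorem mul_mem_spSet {U V : Matrix n n ℍ[ℝ]} (hU : U ∈ SpSet n) (hV : V ∈ SpSet n) :
    U * V ∈ SpSet n := by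
  constructor
  · rw [star_mul, mul_assoc, ← mul_assoc _ U, hU.1, one_mul, hV.1]
  · rw [star_mul, mul_assoc, ← mul_assoc V, hV.2, one_mul, hU.2]

theorem star_mem_spSet {U : Matrix n n ℍ[ℝ]} (hU : U ∈ SpSet n) : star U ∈ SpSet n :=
  ⟨by simpa using hU.2, by simpa using hU.1⟩

theorem qdot_mulVec_mulVec {U : Matrix n n ℍ[ℝ]} (hU : U ∈ SpSet n) (u v : n → ℍ[ℝ]) :
    qdot (U *ᵥ u) (U *ᵥ v) = qdot u v := by
  rw [qdot_mulVec, mulVec_mulVec, hU.1, one_mulVec]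

theorem norm_apply_le_one {U : Matrix n n ℍ[ℝ]} (hU : U ∈ SpSet n) (i j : n) : ‖U i j‖ ≤ 1 := by
  have h1 := congrFun (congrFun hU.1 j) j
  simp only [Matrix.mul_apply, Matrix.star_apply, Matrix.one_apply_eq,
    Quaternion.star_mul_self] at h1
  have h2 : ∑ k, normSq (U k j) = 1 :=
    Quaternion.coe_injective ((map_sum (algebraMap ℝ ℍ[ℝ]) _ _).trans h1)
  have h3 : normSq (U i j) ≤ 1 := by
    rw [← h2]
    exact Finset.single_le_sum (f := fun k => normSq (U k j)) (fun _ _ => normSq_nonneg)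
      (Finset.mem_univ i)
  rw [Quaternion.normSq_eq_norm_mul_self] at h3
  nlinarith [norm_nonneg (U i j)]

/-- There is a unitary matrix moving a unit vector `a` to a unit vector `b` and fixing every
vector orthogonal to both. -/
theorem exists_sp_mulVec_eq {a b : n → ℍ[ℝ]} (ha : qdot a a = 1) (hb : qdot b b = 1) :
    ∃ U ∈ SpSet n, U *ᵥ a = b ∧ ∀ v, qdot a v = 0 → qdot b v = 0 → U *ᵥ v = v := by
  by_cases hab : a = b
  · exact ⟨1, ⟨by simp, by simp⟩, by simpa using hab, by simp⟩
  set w := a - b with hw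
  have hw0 : w ≠ 0 := sub_ne_zero.2 hab
  set q : ℍ[ℝ] := qdot w a with hq
  have hq1 : q = 1 - qdot b a := by rw [hq, hw, sub_qdot, ha]
  have hww : qdot w w = q + star q := by
    rw [hq1, hw, sub_qdot, qdot_sub, qdot_sub, ha, hb, star_sub, star_one, star_qdot]
    abel
  have hq0 : q ≠ 0 := by
    intro h
    rw [h, star_zero, add_zero, qdot_self_eq_zero] at hww
    exact hw0 hww
  have hq0' : star q ≠ 0 := star_ne_zero.2 hq0
  have hU : star (1 - rk w q⁻¹ w) = 1 - rk w (star q)⁻¹ w := by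
    rw [star_sub, star_one, star_rk, star_inv₀]
  refine ⟨1 - rk w q⁻¹ w, ⟨?_, ?_⟩, ?_, ?_⟩
  · rw [hU, sub_mul, one_mul, mul_sub, mul_one, rk_mul_rk, hww, mul_add, add_mul,
      inv_mul_cancel₀ hq0', mul_assoc, mul_inv_cancel₀ hq0, one_mul, mul_one, rk_add]
    abel
  · rw [hU, sub_mul, one_mul, mul_sub, mul_one, rk_mul_rk, hww, mul_add, add_mul,
      inv_mul_cancel₀ hq0, mul_assoc, mul_inv_cancel₀ hq0', one_mul, mul_one, rk_add]
    abel
  · rw [sub_mulVec, one_mulVec, rk_mulVec, inv_mul_cancel₀ hq0, rsmul_one, hw, sub_sub_cancel]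
  · intro v hav hbv
    rw [sub_mulVec, one_mulVec, rk_mulVec, hw, sub_qdot, hav, hbv]
    simp

theorem qdot_single_single {k l : n} (h : k ≠ l) :
    qdot (Pi.single k (1 : ℍ[ℝ])) (Pi.single l 1) = 0 := by
  rw [qdot_single]; simp [h]

theorem qdot_single_self (k : n) : qdot (Pi.single k (1 : ℍ[ℝ])) (Pi.single k 1) = 1 := by
  rw [qdot_single]; simp

theorem exists_sp_mulVec_single {e u : n → ℍ[ℝ]} (he : qdot e e = 1) (hu : qdot u u = 1)
    (heu : qdot e u = 0) {k l : n} (hkl : k ≠ l) :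
    ∃ U ∈ SpSet n, U *ᵥ (Pi.single k 1) = e ∧ U *ᵥ (Pi.single l 1) = u := by
  obtain ⟨U₁, hU₁, h1, -⟩ := exists_sp_mulVec_eq (qdot_single_self k) he
  have hu' : qdot (star U₁ *ᵥ u) (star U₁ *ᵥ u) = 1 := by
    rw [qdot_mulVec_mulVec (star_mem_spSet hU₁), hu]
  have hk' : qdot (star U₁ *ᵥ u) (Pi.single k 1) = 0 := by
    rw [← qdot_mulVec, h1]; exact qdot_comm_eq_zero heu
  obtain ⟨U₂, hU₂, h2, h3⟩ := exists_sp_mulVec_eq (qdot_single_self l) hu'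
  refine ⟨U₁ * U₂, mul_mem_spSet hU₁ hU₂, ?_, ?_⟩
  · rw [← mulVec_mulVec, h3 _ (qdot_single_single hkl.symm) hk', h1]
  · rw [← mulVec_mulVec, h2, mulVec_mulVec, hU₁.2, one_mulVec]

/-- The real trace of a quaternionic matrix. -/
noncomputable def reTrace (n : Type*) [Fintype n] : Matrix n n ℍ[ℝ] →ₗ[ℝ] ℝ where
  toFun X := ∑ i, (X i i).re
  map_add' X Y := by simp [Finset.sum_add_distrib]
  map_smul' r X := by simp [Finset.mul_sum]

theorem reTrace_apply (X : Matrix n n ℍ[ℝ]) : reTrace n X = ∑ i, (X i i).re := rfl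

theorem re_sum {ι : Type*} (s : Finset ι) (f : ι → ℍ[ℝ]) : (∑ i ∈ s, f i).re = ∑ i ∈ s, (f i).re :=
  map_sum (⟨⟨fun x : ℍ[ℝ] => x.re, rfl⟩, fun _ _ => rfl⟩ : ℍ[ℝ] →+ ℝ) f s

theorem re_mul_comm (a b : ℍ[ℝ]) : (a * b).re = (b * a).re := by
  simp; ring

theorem reTrace_mul_comm (X Y : Matrix n n ℍ[ℝ]) : reTrace n (X * Y) = reTrace n (Y * X) := by
  simp only [reTrace_apply, Matrix.mul_apply, re_sum]
  rw [Finset.sum_comm]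
  simp only [re_mul_comm]

theorem reTrace_star_mul_self (X : Matrix n n ℍ[ℝ]) :
    reTrace n (star X * X) = ∑ i, ∑ j, normSq (X j i) := by
  simp [reTrace_apply, Matrix.mul_apply, re_sum, Matrix.star_apply, Quaternion.star_mul_self]

end QuaternionicVectors

section MatrixGroups

open Quaternion Matrix NormedSpace Filter Topology
open scoped Pointwise

set_option linter.unusedSectionVars false

theorem starModule_matrix (n : Type*) [Fintype n] : StarModule ℝ (Matrix n n ℍ[ℝ]) :=
  ⟨fun r X => by ext1 i j; simp [Matrix.star_apply]⟩

attribute [local instance] Matrix.linftyOpNormedRing Matrix.linftyOpNormedAlgebra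

/-- Continuity of the involution, stated for the topology of a normed ring. -/
abbrev HasContinuousStar (A : Type*) [NormedRing A] [StarRing A] : Prop := ContinuousStar A

theorem hasContinuousStar_matrix (n : Type*) [Fintype n] [DecidableEq n] :
    HasContinuousStar (Matrix n n ℍ[ℝ]) :=
  ⟨continuous_id.matrix_conjTranspose⟩

/-- Compatibility of the involution with real scalars, stated for a normed algebra. -/
abbrev HasStarModule (A : Type*) [NormedRing A] [StarRing A] [NormedAlgebra ℝ A] : Prop :=
  StarModule ℝ A

theorem hasStarModule_matrix (n : Type*) [Fintype n] [DecidableEq n] :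
    HasStarModule (Matrix n n ℍ[ℝ]) :=
  ⟨(starModule_matrix n).star_smul⟩

attribute [local instance] hasContinuousStar_matrix hasStarModule_matrix

variable {n : Type*} [Fintype n] [DecidableEq n]

theorem isTraceForm_reTrace : IsTraceForm (reTrace n) where
  mul_comm := reTrace_mul_comm
  map_star X := by simp [reTrace_apply, Matrix.star_apply]
  nonneg X := by
    rw [reTrace_star_mul_self]
    exact Finset.sum_nonneg fun _ _ => Finset.sum_nonneg fun _ _ => normSq_nonneg
  eq_zero X h := by
    rw [reTrace_star_mul_self, Finset.sum_eq_zero_iff_of_nonneg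
      fun _ _ => Finset.sum_nonneg fun _ _ => normSq_nonneg] at h
    ext1 i j
    have h1 := h j (Finset.mem_univ _)
    rw [Finset.sum_eq_zero_iff_of_nonneg fun _ _ => normSq_nonneg] at h1
    simpa using h1 i (Finset.mem_univ _)

theorem isCompactUnitary_of_subset_spSet {G : Set (Matrix n n ℍ[ℝ])} (hG : IsMatSubgroup G)
    (hsub : G ⊆ SpSet n) (hcl : IsClosed G) : IsCompactUnitary G where
  one_mem := hG.1
  mul_mem := hG.2.1
  star_mem := hG.2.2
  star_mul_self a ha := (hsub ha).1
  isCompact := by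
    have hK : IsCompact (Set.univ.pi fun _ : n => Set.univ.pi fun _ : n =>
        Metric.closedBall (0 : ℍ[ℝ]) 1) :=
      isCompact_univ_pi fun _ => isCompact_univ_pi fun _ => isCompact_closedBall _ _
    refine hK.of_isClosed_subset hcl fun U hU => ?_
    simp only [Set.mem_pi, Set.mem_univ, true_imp_iff, mem_closedBall_zero_iff]
    intro i j
    exact norm_apply_le_one (hsub hU) i j

theorem IsCompactUnitary.subset_spSet {G : Set (Matrix n n ℍ[ℝ])} (hG : IsCompactUnitary G) :
    G ⊆ SpSet n := fun _ ha => ⟨hG.star_mul_self _ ha, hG.mul_star_self ha⟩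

theorem exp_mem_spSet {X : Matrix n n ℍ[ℝ]} (hX : star X = -X) (t : ℝ) : exp (t • X) ∈ SpSet n :=
  ⟨star_exp_smul_mul_self hX t, exp_smul_mul_star_self hX t⟩

theorem spSet_isMatSubgroup : IsMatSubgroup (SpSet n) :=
  ⟨⟨by simp, by simp⟩, fun _ ha _ hb => mul_mem_spSet ha hb, fun _ ha => star_mem_spSet ha⟩

theorem isClosed_spSet : IsClosed (SpSet n) := by
  refine IsClosed.inter (s₁ := {U : Matrix n n ℍ[ℝ] | star U * U = 1})
    (s₂ := {U : Matrix n n ℍ[ℝ] | U * star U = 1}) ?_ ?_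
  · exact isClosed_eq (by fun_prop) continuous_const
  · exact isClosed_eq (by fun_prop) continuous_const

/-- A compact group of quaternionic unitary matrices commuting with an orthogonal projection `P`
whose Lie algebra contains every skew-Hermitian matrix commuting with `P` contains every unitary
matrix commuting with `P`. -/
theorem mem_of_forall_skew_commute_mem_lie {G : Set (Matrix n n ℍ[ℝ])} (hG : IsCompactUnitary G)
    {P : Matrix n n ℍ[ℝ]} (hP : star P = P) (hPP : P * P = P) (hGP : ∀ g ∈ G, g * P = P * g)
    (h : ∀ X : Matrix n n ℍ[ℝ], star X = -X → X * P = P * X → X ∈ hG.lie)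
    {U : Matrix n n ℍ[ℝ]} (hU : U ∈ SpSet n) (hUP : U * P = P * U) : U ∈ G := by
  set τ := reTrace n
  have hτ : IsTraceForm τ := isTraceForm_reTrace
  have hτc : Continuous τ := τ.continuous_of_finiteDimensional
  obtain ⟨g, hg, hmax⟩ := hG.isCompact.exists_isMaxOn ⟨1, hG.one_mem⟩
    (f := fun g => τ (g * U)) (by fun_prop)
  set B := g * U with hB
  have hBsp : B ∈ SpSet n := mul_mem_spSet (hG.subset_spSet hg) hU
  have hBP : B * P = P * B := by
    rw [hB, mul_assoc, hUP, ← mul_assoc, hGP g hg, mul_assoc]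
  have hle (X : Matrix n n ℍ[ℝ]) (hX : star X = -X) (hXP : X * P = P * X) (t : ℝ) :
        τ (exp (t • X) * B) ≤ τ B := by
    have h1 : τ (exp (t • X) * g * U) ≤ τ (g * U) :=
      hmax (hG.mul_mem _ (hG.exp_mem (h X hX hXP) t) _ hg)
    rwa [mul_assoc] at h1
  have hherm : star B = B := by
    set X := B - star B with hX
    have hXs : star X = -X := by rw [hX, star_sub, star_star, neg_sub]
    have hXP : X * P = P * X := by
      have h1 : star B * P = P * star B := by
        have h2 := congrArg star hBP
        rw [star_mul B P, star_mul P B, hP] at h2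
        exact h2.symm
      rw [hX, sub_mul, mul_sub, hBP, h1]
    have hd := hasDerivAt_trace_mul_exp τ B X
    have h0 : τ (B * X) = 0 := by
      refine IsLocalMax.hasDerivAt_eq_zero (.of_forall fun θ => ?_) hd
      change τ (B * exp (θ • X)) ≤ τ (B * exp ((0 : ℝ) • X))
      rw [hτ.mul_comm, zero_smul, exp_zero, mul_one]
      exact hle X hXs hXP θ
    have h1 : τ (star B * X) = 0 := by
      rw [← hτ.map_star, star_mul, star_star, hXs, neg_mul, map_neg, hτ.mul_comm, h0, neg_zero]
    have h2 : τ (star X * X) = 0 := by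
      have : star X * X = star B * X - B * X := by
        rw [← sub_mul, hX, star_sub, star_star]
      rw [this, map_sub, h0, h1, sub_zero]
    exact (sub_eq_zero.1 (hτ.eq_zero X h2)).symm
  have hBB : B * B = 1 := by
    have := hBsp.1
    rwa [hherm] at this
  have hB1 : B = 1 := by
    by_contra hne
    obtain ⟨v, hv, hvP⟩ : ∃ v, v - B *ᵥ v ≠ 0 ∧ (P *ᵥ v = v ∨ P *ᵥ v = 0) := by
      by_contra! hall
      refine hne (ext_mulVec fun u => ?_)
      have h1 : P *ᵥ u - B *ᵥ (P *ᵥ u) = 0 := by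
        by_contra hu
        exact (hall _ hu).1 (by rw [mulVec_mulVec, hPP])
      have h2 : (u - P *ᵥ u) - B *ᵥ (u - P *ᵥ u) = 0 := by
        by_contra hu
        exact (hall _ hu).2 (by rw [mulVec_sub, mulVec_mulVec, hPP, sub_self])
      rw [one_mulVec, ← sub_eq_zero, ← neg_sub, neg_eq_zero, ← add_zero (0 : n → ℍ[ℝ])]
      nth_rewrite 1 [← h1]
      rw [← h2, mulVec_sub]
      abel
    set u := v - B *ᵥ v with hu
    have huP : P *ᵥ u = u ∨ P *ᵥ u = 0 := by
      rw [hu, mulVec_sub, mulVec_mulVec, ← hBP, ← mulVec_mulVec]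
      rcases hvP with h1 | h1
      · left; rw [h1]
      · right; rw [h1, mulVec_zero, sub_self]
    have hBu : B *ᵥ u = -u := by
      rw [hu, mulVec_sub, mulVec_mulVec, hBB, one_mulVec, neg_sub]
    set X := rk u qi u with hX
    have hXs : star X = -X := by rw [hX, star_rk, star_qi, rk_neg]
    have hXP : X * P = P * X := by
      rw [hX, rk_mul, mul_rk, hP]
      rcases huP with h1 | h1
      · rw [h1]
      · rw [h1, zero_rk, rk_zero_right]
    have hXB : X * (B + 1) = 0 := by
      rw [mul_add, mul_one, hX, rk_mul, hherm, hBu, ← neg_one_smul ℝ u, rk_smul_right]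
      simp
    have hexp (t : ℝ) : exp (t • X) * (B + 1) = B + 1 := by
      have hder (s : ℝ) : HasDerivAt (fun s : ℝ => exp (s • X) * (B + 1)) 0 s := by
        have h1 := (hasDerivAt_exp_smul_const (𝕂 := ℝ) X s).mul_const (B + 1)
        rwa [mul_assoc, hXB, mul_zero] at h1
      have h2 := is_const_of_deriv_eq_zero (fun s => (hder s).differentiableAt)
        (fun s => (hder s).deriv) t 0
      simpa using h2
    have hexp1 (t : ℝ) : exp (t • X) = 1 := by
      refine hτ.eq_one (star_exp_smul_mul_self hXs t) ?_
      have h1 := hle X hXs hXP t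
      have h2 := congrArg τ (hexp t)
      simp only [mul_add, mul_one, map_add] at h2
      linarith
    have hX0 : X = 0 := by
      have h1 : HasDerivAt (fun t : ℝ => exp (t • X)) X 0 := hasDerivAt_exp_smul_zero X
      rw [funext hexp1] at h1
      exact h1.unique (hasDerivAt_const _ _)
    have h1 : X *ᵥ u = rsmul u (qi * qdot u u) := by rw [hX, rk_mulVec]
    rw [hX0, zero_mulVec] at h1
    have h2 : qdot u (rsmul u (qi * qdot u u)) = 0 := by rw [← h1, qdot_zero]
    rw [qdot_rsmul, mul_eq_zero, mul_eq_zero] at h2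
    have h3 : qdot u u ≠ 0 := fun h => hv (qdot_self_eq_zero.1 h)
    have h4 : qi ≠ 0 := fun h => by simpa using congrArg QuaternionAlgebra.imI h
    tauto
  have : U = star g := by
    calc U = star g * g * U := by rw [hG.star_mul_self _ hg, one_mul]
      _ = star g := by rw [mul_assoc, ← hB, hB1, mul_one]
  rw [this]
  exact hG.star_mem _ hg

/-- If the Lie algebras of two compact groups of unitary matrices span all skew-Hermitian
matrices, then every unitary matrix is a product of elements of the two groups. -/
theorem spSet_subset_mul {G H : Set (Matrix n n ℍ[ℝ])} (hG : IsCompactUnitary G)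
    (hH : IsCompactUnitary H)
    (h : ∀ X : Matrix n n ℍ[ℝ], star X = -X → X ∈ hG.lie ⊔ hH.lie) : SpSet n ⊆ G * H := by
  let Γ : Set (Matrix n n ℍ[ℝ]) :=
    {U | U ∈ SpSet n ∧ ∀ s ∈ G * H, s * U ∈ G * H ∧ s * star U ∈ G * H}
  have hcl : IsClosed (G * H) := (hG.isCompact.mul hH.isCompact).isClosed
  have hΓcl : IsClosed Γ := by
    have : Γ = SpSet n ∩ ⋂ s ∈ G * H, {U | s * U ∈ G * H} ∩ {U | s * star U ∈ G * H} := by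
      ext U; simp [Γ]
    rw [this]
    refine isClosed_spSet.inter (isClosed_biInter fun s _ => ?_)
    exact (hcl.preimage (by fun_prop)).inter (hcl.preimage (by fun_prop))
  have hΓgrp : IsMatSubgroup Γ := by
    refine ⟨⟨spSet_isMatSubgroup.1, fun s hs => by simpa using hs⟩, ?_, ?_⟩
    · rintro a ⟨ha, ha'⟩ b ⟨hb, hb'⟩
      refine ⟨mul_mem_spSet ha hb, fun s hs => ⟨?_, ?_⟩⟩
      · rw [← mul_assoc]; exact (hb' _ (ha' _ hs).1).1
      · rw [star_mul, ← mul_assoc]; exact (ha' _ (hb' _ hs).2).2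
    · rintro a ⟨ha, ha'⟩
      exact ⟨star_mem_spSet ha, fun s hs => ⟨(ha' s hs).2, by simpa using (ha' s hs).1⟩⟩
  have hΓ := isCompactUnitary_of_subset_spSet hΓgrp (fun _ h => h.1) hΓcl
  intro U hU
  have hmem : U ∈ Γ := by
    refine mem_of_forall_skew_commute_mem_lie hΓ (star_zero _) (mul_zero 0)
      (fun _ _ => by rw [mul_zero, zero_mul])
      (fun X hX _ t => ⟨exp_mem_spSet hX t, fun s hs => ?_⟩) hU (by rw [mul_zero, zero_mul])
    refine ⟨mul_exp_mem_mul hG hH h hs hX t, ?_⟩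
    rw [star_exp_smul hX]
    exact mul_exp_mem_mul hG hH h hs hX (-t)
  simpa using (hmem.2 1 ⟨1, hG.one_mem, 1, hH.one_mem, by simp⟩).1

end MatrixGroups

section OrthogonalDecomposition

/-- Orthogonal decomposition with respect to a definite symmetric form. -/
theorem exists_mem_forall_bilin_sub_eq_zero {V : Type*} [AddCommGroup V] [Module ℝ V]
    [FiniteDimensional ℝ V] (B : LinearMap.BilinForm ℝ V) (hB : B.IsSymm)
    (hdef : ∀ x, B x x = 0 → x = 0) (W : Submodule ℝ V) (x : V) :
    ∃ b ∈ W, ∀ z ∈ W, B z (x - b) = 0 := by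
  have hd : Disjoint W (B.orthogonal W) := by
    rw [Submodule.disjoint_def]
    intro z hz hz'
    exact hdef z (LinearMap.BilinForm.mem_orthogonal_iff.1 hz' z hz)
  have hc := LinearMap.BilinForm.isCompl_orthogonal_of_restrict_nondegenerate hB.isRefl
    (LinearMap.BilinForm.nondegenerate_restrict_of_disjoint_orthogonal B hB.isRefl hd)
  obtain ⟨b, hb, c, hc', hbc⟩ := Submodule.mem_sup.1 (hc.sup_eq_top ▸ Submodule.mem_top (x := x))
  refine ⟨b, hb, fun z hz => ?_⟩
  rw [← hbc, add_sub_cancel_left]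
  exact LinearMap.BilinForm.mem_orthogonal_iff.1 hc' z hz

theorem finrank_map_le_finrank_map_ker_add {V W U : Type*} [AddCommGroup V] [Module ℝ V]
    [FiniteDimensional ℝ V] [AddCommGroup W] [Module ℝ W] [FiniteDimensional ℝ W]
    [AddCommGroup U] [Module ℝ U] (s : Submodule ℝ V) (f : V →ₗ[ℝ] U) (g : V →ₗ[ℝ] W) :
    finrank ℝ (s.map f) ≤ finrank ℝ ((s ⊓ LinearMap.ker g).map f) + finrank ℝ W := by
  obtain ⟨C, hC⟩ := Submodule.exists_isCompl ((LinearMap.ker g).submoduleOf s)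
  have h1 : s.map f ≤ (s ⊓ LinearMap.ker g).map f ⊔ (C.map s.subtype).map f := by
    rw [← Submodule.map_sup]
    refine Submodule.map_mono fun x hx => ?_
    obtain ⟨a, ha, c, hc, hac⟩ := Submodule.mem_sup.1
      (hC.sup_eq_top ▸ Submodule.mem_top (x := (⟨x, hx⟩ : s)))
    have h2 : (a : V) + c = x := congrArg Subtype.val hac
    rw [← h2]
    exact Submodule.add_mem_sup ⟨a.2, ha⟩ ⟨c, hc, rfl⟩
  have h2 : finrank ℝ C ≤ finrank ℝ W := by
    refine LinearMap.finrank_le_finrank_of_injective (f := (g ∘ₗ s.subtype) ∘ₗ C.subtype) ?_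
    rw [← LinearMap.ker_eq_bot, LinearMap.ker_eq_bot']
    intro c hc
    have h3 : (c : s) ∈ (⊥ : Submodule ℝ s) := by
      rw [← hC.inf_eq_bot]
      exact ⟨hc, c.2⟩
    exact Subtype.ext h3
  calc finrank ℝ (s.map f) ≤ _ := Submodule.finrank_mono h1
    _ ≤ _ := Submodule.finrank_add_le_finrank_add_finrank _ _
    _ ≤ _ := by
      gcongr
      exact (Submodule.finrank_map_le _ _).trans ((Submodule.finrank_map_le _ _).trans h2)

end OrthogonalDecomposition

section QuaternionicLinear

open Quaternion Matrix

set_option linter.unusedSectionVars false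

variable {n : Type*} [Fintype n] [DecidableEq n]

/-- The map `u ↦ v* u` as a real linear map. -/
noncomputable def qdotL (v : n → ℍ[ℝ]) : (n → ℍ[ℝ]) →ₗ[ℝ] ℍ[ℝ] where
  toFun := qdot v
  map_add' := qdot_add v
  map_smul' r u := qdot_smul r v u

/-- Right multiplication by a quaternion as a real linear map. -/
noncomputable def rsmulL (c : ℍ[ℝ]) : (n → ℍ[ℝ]) →ₗ[ℝ] (n → ℍ[ℝ]) where
  toFun u := rsmul u c
  map_add' u v := add_rsmul u v c
  map_smul' r u := smul_rsmul r u c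

/-- The parametrization `c ↦ u c` of a quaternionic line. -/
noncomputable def lineL (u : n → ℍ[ℝ]) : ℍ[ℝ] →ₗ[ℝ] (n → ℍ[ℝ]) where
  toFun := rsmul u
  map_add' := rsmul_add u
  map_smul' r c := rsmul_smul r u c

/-- Evaluation of matrices at a vector. -/
noncomputable def evalL (u : n → ℍ[ℝ]) : Matrix n n ℍ[ℝ] →ₗ[ℝ] (n → ℍ[ℝ]) where
  toFun X := X *ᵥ u
  map_add' X Y := add_mulVec X Y u
  map_smul' r X := smul_mulVec r X u

/-- A matrix as a real linear endomorphism. -/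
noncomputable def actL (X : Matrix n n ℍ[ℝ]) : (n → ℍ[ℝ]) →ₗ[ℝ] (n → ℍ[ℝ]) where
  toFun u := X *ᵥ u
  map_add' := mulVec_add X
  map_smul' r u := by simpa using mulVec_smul X r u

theorem finrank_ker_qdotL {e : n → ℍ[ℝ]} (he : qdot e e = 1) :
    finrank ℝ (LinearMap.ker (qdotL e)) + 4 = 4 * Fintype.card n := by
  have hs : Function.Surjective (qdotL e) := fun c =>
    ⟨rsmul e c, (qdot_rsmul e e c).trans (by rw [he, one_mul])⟩
  have h1 := LinearMap.finrank_range_add_finrank_ker (qdotL e)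
  rw [LinearMap.range_eq_top.2 hs, finrank_top, Quaternion.finrank_eq_four,
    Module.finrank_pi_fintype] at h1
  simp only [Quaternion.finrank_eq_four, Finset.sum_const, Finset.card_univ, smul_eq_mul] at h1
  omega

theorem exists_ne_zero_qdot_eq_zero (hn : 2 < Fintype.card n) (e u : n → ℍ[ℝ]) :
    ∃ w : n → ℍ[ℝ], w ≠ 0 ∧ qdot e w = 0 ∧ qdot u w = 0 := by
  have h : LinearMap.ker ((qdotL e).prod (qdotL u)) ≠ ⊥ := by
    refine LinearMap.ker_ne_bot_of_finrank_lt ?_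
    rw [Module.finrank_prod, Module.finrank_pi_fintype]
    simp only [Quaternion.finrank_eq_four, Finset.sum_const, Finset.card_univ, smul_eq_mul]
    omega
  obtain ⟨w, hw, hw0⟩ := Submodule.exists_mem_ne_zero_of_ne_bot h
  exact ⟨w, hw0, congrArg Prod.fst (LinearMap.mem_ker.1 hw),
    congrArg Prod.snd (LinearMap.mem_ker.1 hw)⟩

/-- The real inner product on quaternionic vectors. -/
noncomputable def reDot (n : Type*) [Fintype n] [DecidableEq n] :
    LinearMap.BilinForm ℝ (n → ℍ[ℝ]) :=
  LinearMap.mk₂ ℝ (fun v u => (qdot v u).re) (fun v v' u => by simp [add_qdot])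
    (fun r v u => by simp [smul_qdot]) (fun v u u' => by simp [qdot_add])
    (fun r v u => by simp [qdot_smul])

theorem reDot_apply (v u : n → ℍ[ℝ]) : reDot n v u = (qdot v u).re := rfl

theorem reDot_isSymm : (reDot n).IsSymm :=
  ⟨fun v u => by simp only [reDot_apply, ← star_qdot v u, Quaternion.re_star]⟩

theorem reDot_self (v : n → ℍ[ℝ]) : reDot n v v = nsq v := by
  rw [reDot_apply, qdot_self, Quaternion.re_coe]

/-- The real inner product on quaternionic matrices. -/
noncomputable def reTraceForm (n : Type*) [Fintype n] [DecidableEq n] :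
    LinearMap.BilinForm ℝ (Matrix n n ℍ[ℝ]) :=
  LinearMap.mk₂ ℝ (fun X Y => reTrace n (star X * Y)) (fun X X' Y => by simp [add_mul])
    (fun r X Y => by simp [star_real_smul]) (fun X Y Y' => by simp [mul_add])
    (fun r X Y => by simp)

theorem reTraceForm_apply (X Y : Matrix n n ℍ[ℝ]) :
    reTraceForm n X Y = reTrace n (star X * Y) := rfl

theorem reTrace_star (X : Matrix n n ℍ[ℝ]) : reTrace n (star X) = reTrace n X := by
  simp [reTrace_apply, Matrix.star_apply]

theorem eq_zero_of_reTrace_star_mul_self {X : Matrix n n ℍ[ℝ]}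
    (h : reTrace n (star X * X) = 0) : X = 0 := by
  rw [reTrace_star_mul_self, Finset.sum_eq_zero_iff_of_nonneg
    fun _ _ => Finset.sum_nonneg fun _ _ => normSq_nonneg] at h
  ext1 i j
  have h1 := h j (Finset.mem_univ _)
  rw [Finset.sum_eq_zero_iff_of_nonneg fun _ _ => normSq_nonneg] at h1
  simpa using h1 i (Finset.mem_univ _)

theorem reTraceForm_isSymm : (reTraceForm n).IsSymm :=
  ⟨fun X Y => by
    simp only [reTraceForm_apply, ← reTrace_star (star X * Y), star_mul, star_star]⟩

theorem qdot_mulVec_of_skew {X : Matrix n n ℍ[ℝ]} (hX : star X = -X) (v u : n → ℍ[ℝ]) :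
    qdot v (X *ᵥ u) = -qdot (X *ᵥ v) u := by
  rw [qdot_mulVec, hX, neg_mulVec, neg_qdot]

theorem star_qdot_mulVec_self {X : Matrix n n ℍ[ℝ]} (hX : star X = -X) (v : n → ℍ[ℝ]) :
    star (qdot v (X *ᵥ v)) = -qdot v (X *ᵥ v) := by
  rw [star_qdot, qdot_mulVec_of_skew hX v, neg_neg]

/-- A nonzero skew-Hermitian matrix has a unit eigenvector with eigenvalue a nonzero multiple
of `i`. -/
theorem exists_eigenvector_of_skew {Y : Matrix n n ℍ[ℝ]} (hY : star Y = -Y) (hY0 : Y ≠ 0) :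
    ∃ (u : n → ℍ[ℝ]) (r : ℝ), r ≠ 0 ∧ qdot u u = 1 ∧ Y *ᵥ u = rsmul u (r • qi) := by
  obtain ⟨v, μ, hv, hμ, hvμ⟩ : ∃ (v : n → ℍ[ℝ]) (μ : ℝ), v ≠ 0 ∧ μ ≠ 0 ∧
      Y *ᵥ (Y *ᵥ v) = μ • v := by
    set L := WithLp.linearEquiv 2 ℝ (n → ℍ[ℝ]) with hL
    set T : PiLp 2 (fun _ : n => ℍ[ℝ]) →ₗ[ℝ] PiLp 2 (fun _ : n => ℍ[ℝ]) :=
      L.symm.toLinearMap ∘ₗ (actL Y ∘ₗ actL Y) ∘ₗ L.toLinearMap with hT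
    have hinner (x y : PiLp 2 (fun _ : n => ℍ[ℝ])) : inner ℝ x y = (qdot (L x) (L y)).re := by
      rw [PiLp.inner_apply, qdot, re_sum]
      refine Finset.sum_congr rfl fun i _ => ?_
      rw [Quaternion.inner_def, ← Quaternion.re_star, star_mul, star_star, re_mul_comm]
      rfl
    have hsym : T.IsSymmetric := fun x y => by
      rw [hinner, hinner]
      change (qdot (Y *ᵥ (Y *ᵥ L x)) (L y)).re = (qdot (L x) (Y *ᵥ (Y *ᵥ L y))).re
      rw [qdot_mulVec_of_skew hY, qdot_mulVec_of_skew hY, neg_neg]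
    by_contra! hcon
    have hT0 : T = 0 := by
      refine (hsym.eigenvectorBasis rfl).toBasis.ext fun i => ?_
      rw [OrthonormalBasis.coe_toBasis, hsym.apply_eigenvectorBasis]
      by_contra hne
      have hμ : hsym.eigenvalues rfl i ≠ 0 := fun h => hne (by simp [h])
      refine hcon (L (hsym.eigenvectorBasis rfl i)) (hsym.eigenvalues rfl i) ?_ hμ ?_
      · intro h
        have : hsym.eigenvectorBasis rfl i = 0 := L.map_eq_zero_iff.1 h
        have h1 := (hsym.eigenvectorBasis rfl).orthonormal.1 i
        rw [this, norm_zero] at h1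
        exact zero_ne_one h1
      · exact congrArg L (hsym.apply_eigenvectorBasis rfl i)
    refine hY0 (ext_mulVec fun w => ?_)
    have h1 : Y *ᵥ (Y *ᵥ w) = 0 := congrArg L (LinearMap.congr_fun hT0 (L.symm w))
    rw [zero_mulVec, ← qdot_self_eq_zero, qdot_mulVec_of_skew hY, h1, zero_qdot, neg_zero]
  have hneg : μ < 0 := by
    have h1 : (qdot v (Y *ᵥ (Y *ᵥ v))).re = μ * nsq v := by
      rw [hvμ, qdot_smul, qdot_self]; simp
    rw [qdot_mulVec_of_skew hY, qdot_self] at h1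
    simp only [Quaternion.re_neg, Quaternion.re_coe] at h1
    have h2 := nsq_nonneg (Y *ᵥ v)
    have h3 := nsq_pos hv
    refine lt_of_le_of_ne ?_ hμ
    nlinarith
  set r := √(-μ) with hr
  have hr0 : 0 < r := Real.sqrt_pos.2 (by linarith)
  have hrr : r * r = -μ := Real.mul_self_sqrt (by linarith)
  have key (c : ℍ[ℝ]) (z : n → ℍ[ℝ]) (hz : z = rsmul (Y *ᵥ v) c - r • rsmul v (c * qi)) :
      Y *ᵥ z = rsmul z (-r • qi) := by
    have h2 : Y *ᵥ (r • rsmul v (c * qi)) = r • rsmul (Y *ᵥ v) (c * qi) := by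
      rw [← mulVec_rsmul]
      exact (actL Y).map_smul r _
    rw [hz, mulVec_sub, mulVec_rsmul, hvμ, h2, sub_rsmul, smul_rsmul, smul_rsmul, rsmul_rsmul,
      rsmul_rsmul]
    rw [mul_smul_comm, mul_smul_comm, mul_assoc, qi_mul_qi, rsmul_smul, rsmul_smul, mul_neg,
      mul_one, rsmul_neg, smul_neg,
      show r • -(-r • rsmul v c) = -(μ • rsmul v c) by
        rw [neg_smul, neg_neg, smul_smul, hrr, neg_smul], neg_smul]
    abel
  obtain ⟨z, hz0, hz⟩ : ∃ z : n → ℍ[ℝ], z ≠ 0 ∧ Y *ᵥ z = rsmul z (-r • qi) := by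
    by_cases h1 : rsmul (Y *ᵥ v) 1 - r • rsmul v (1 * qi) = 0
    · refine ⟨_, fun h2 => hv ?_, key qj _ rfl⟩
      rw [sub_eq_zero, rsmul_one, one_mul] at h1
      rw [h1, smul_rsmul, rsmul_rsmul, ← smul_sub, ← rsmul_sub] at h2
      have h3 := (smul_eq_zero_iff_right hr0.ne').1 h2
      have h4 : qi * qj - qj * qi ≠ (0 : ℍ[ℝ]) := by
        intro h
        have := congrArg (fun x : ℍ[ℝ] => x.imK) h
        norm_num at this
      ext1 i
      exact (mul_eq_zero.1 (congrFun h3 i)).resolve_right h4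
    · exact ⟨_, h1, key 1 _ rfl⟩
  obtain ⟨s, u, hs, hu, hzu⟩ := exists_unit_smul hz0
  refine ⟨u, -r, neg_ne_zero.2 hr0.ne', hu, ?_⟩
  have h1 : s • (Y *ᵥ u) = s • rsmul u (-r • qi) := by
    rw [← smul_rsmul, ← hzu, ← hz, hzu]
    exact ((actL Y).map_smul s u).symm
  exact smul_right_injective _ hs.ne' h1

end QuaternionicLinear

section TransitiveSubalgebra

open Quaternion Matrix

set_option linter.unusedSectionVars false

variable {n : Type*} [Fintype n] [DecidableEq n]

/-- A Lie algebra of skew-Hermitian matrices acting transitively, at the infinitesimal level, on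
quaternionic lines and on pairs of orthogonal quaternionic lines. -/
structure IsLineTransitive (g : Submodule ℝ (Matrix n n ℍ[ℝ])) : Prop where
  star_eq_neg : ∀ X ∈ g, star X = -X
  bracket_mem : ∀ X ∈ g, ∀ Y ∈ g, X * Y - Y * X ∈ g
  exists_line : ∀ e w : n → ℍ[ℝ], qdot e e = 1 → qdot e w = 0 →
    ∃ X ∈ g, ∃ a, X *ᵥ e = w + rsmul e a
  exists_pair : ∀ e u w : n → ℍ[ℝ], qdot e e = 1 → qdot u u = 1 → qdot e u = 0 →
    qdot e w = 0 → qdot u w = 0 → ∃ X ∈ g, ∃ a b, X *ᵥ e = rsmul e a ∧ X *ᵥ u = w + rsmul u b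

namespace IsLineTransitive

variable {g : Submodule ℝ (Matrix n n ℍ[ℝ])}

theorem rk_mem (hg : IsLineTransitive g) (hn : 5 ≤ Fintype.card n) {e : n → ℍ[ℝ]}
    (he : qdot e e = 1) {x : Matrix n n ℍ[ℝ]} (hx : x ∈ g) {α : ℍ[ℝ]}
    (hxe : x *ᵥ e = rsmul e α) : rk e α e ∈ g := by
  have hα : star α = -α := by
    have h := star_qdot_mulVec_self (hg.star_eq_neg x hx) e
    rwa [hxe, qdot_rsmul, he, one_mul] at h
  set b : Submodule ℝ (Matrix n n ℍ[ℝ]) := g ⊓ LinearMap.ker (evalL e) with hb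
  have hbe {B : Matrix n n ℍ[ℝ]} (hB : B ∈ b) : B *ᵥ e = 0 := hB.2
  obtain ⟨b₀, hb₀, hperp⟩ := exists_mem_forall_bilin_sub_eq_zero (reTraceForm n)
    reTraceForm_isSymm (fun _ => eq_zero_of_reTrace_star_mul_self) b x
  set y := x - b₀ with hy
  have hyg : y ∈ g := g.sub_mem hx hb₀.1
  have hye : y *ᵥ e = rsmul e α := by rw [hy, sub_mulVec, hbe hb₀, sub_zero, hxe]
  have hcomm {B : Matrix n n ℍ[ℝ]} (hB : B ∈ b) : y * B = B * y := by
    have h1 : y * B - B * y ∈ b := by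
      refine ⟨hg.bracket_mem y hyg B hB.1, ?_⟩
      change (y * B - B * y) *ᵥ e = 0
      rw [sub_mulVec, ← mulVec_mulVec, ← mulVec_mulVec, hbe hB, hye, mulVec_rsmul, hbe hB,
        mulVec_zero, zero_rsmul, sub_zero]
    set C := y * B - B * y with hC
    have hCs := hg.star_eq_neg C h1.1
    have hBs := hg.star_eq_neg B hB.1
    have h2 : B * C - C * B ∈ b := by
      refine ⟨hg.bracket_mem B hB.1 C h1.1, ?_⟩
      change (B * C - C * B) *ᵥ e = 0
      rw [sub_mulVec, ← mulVec_mulVec, ← mulVec_mulVec, hbe hB, hbe h1, mulVec_zero,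
        mulVec_zero, sub_zero]
    have h3 : reTrace n (star (B * C - C * B) * y) = 0 := hperp _ h2
    have h4 : reTrace n (star C * C) = 0 := by
      have e1 : reTrace n (C * (y * B)) = reTrace n (B * C * y) := by
        rw [← mul_assoc, reTrace_mul_comm, mul_assoc]
      have e2 : star (B * C - C * B) = -(B * C - C * B) :=
        hg.star_eq_neg _ h2.1
      rw [e2, neg_mul, map_neg, sub_mul, map_sub] at h3
      rw [hCs, neg_mul, map_neg]
      conv_lhs => rw [hC]
      rw [← hC, mul_sub, map_sub, e1, ← mul_assoc C B y]
      exact h3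
    exact sub_eq_zero.1 (eq_zero_of_reTrace_star_mul_self h4)
  set y' := y - rk e α e with hy'
  have hys : star y = -y := hg.star_eq_neg y hyg
  have hy's : star y' = -y' := by rw [hy', star_sub, star_rk, hα, hys, rk_neg]; abel
  have hy'e : y' *ᵥ e = 0 := by
    rw [hy', sub_mulVec, hye, rk_mulVec, he, mul_one, sub_self]
  have hcomm' {B : Matrix n n ℍ[ℝ]} (hB : B ∈ b) : y' * B = B * y' := by
    rw [hy', sub_mul, mul_sub, hcomm hB, rk_mul, mul_rk, hg.star_eq_neg B hB.1, neg_mulVec,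
      hbe hB, neg_zero, rk_zero_right, zero_rk]
  by_cases hy0 : y' = 0
  · rwa [← sub_eq_zero.1 hy0]
  exfalso
  obtain ⟨u, r, hr, hu, hyu⟩ := exists_eigenvector_of_skew hy's hy0
  have hrq : (r • qi : ℍ[ℝ]) ≠ 0 := fun h => hr (by simpa using congrArg (fun x : ℍ[ℝ] => x.imI) h)
  have heu : qdot e u = 0 := by
    have h1 := qdot_mulVec_of_skew hy's e u
    rw [hy'e, zero_qdot, neg_zero, hyu, qdot_rsmul] at h1
    exact (mul_eq_zero.1 h1).resolve_right hrq
  set E := LinearMap.ker (qdotL e) with hE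
  set F : Submodule ℝ (n → ℍ[ℝ]) := E ⊓ LinearMap.ker (actL y' - rsmulL (r • qi)) with hF
  have hFmem {v : n → ℍ[ℝ]} (hv : v ∈ F) : qdot e v = 0 ∧ y' *ᵥ v = rsmul v (r • qi) :=
    ⟨hv.1, sub_eq_zero.1 hv.2⟩
  have hEF : 2 * finrank ℝ F ≤ finrank ℝ E := by
    have hinj : Function.Injective (rsmulL qj : (n → ℍ[ℝ]) →ₗ[ℝ] (n → ℍ[ℝ])) := by
      intro v w hvw
      have h1 : rsmul (rsmul v qj) qj = rsmul (rsmul w qj) qj := congrArg (rsmul · qj) hvw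
      simpa [rsmul_rsmul, qj_mul_qj, rsmul_neg] using h1
    have h1 : finrank ℝ (F.map (rsmulL qj)) = finrank ℝ F :=
      (LinearEquiv.finrank_eq (Submodule.equivMapOfInjective _ hinj F)).symm
    have h2 : F ⊓ F.map (rsmulL qj) = ⊥ := by
      rw [eq_bot_iff]
      rintro v ⟨hv, w, hw, hwv⟩
      have hwv : rsmul w qj = v := hwv
      have e1 := (hFmem hv).2
      have e2 : y' *ᵥ v = rsmul (rsmul w (r • qi)) qj := by
        rw [← hwv, mulVec_rsmul, (hFmem hw).2]
      rw [e2, ← hwv, rsmul_rsmul, rsmul_rsmul, ← sub_eq_zero, ← rsmul_sub] at e1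
      have e3 : (r • qi * qj - qj * r • qi : ℍ[ℝ]) ≠ 0 := by
        intro h
        have := congrArg (fun x : ℍ[ℝ] => x.imK) h
        simp at this
        exact hr (by linarith)
      have e4 : w = 0 := by
        ext1 i
        exact (mul_eq_zero.1 (congrFun e1 i)).resolve_right e3
      rw [← hwv, e4, zero_rsmul]
      exact Submodule.zero_mem _
    have h3 : F ⊔ F.map (rsmulL qj) ≤ E := by
      refine sup_le inf_le_left ?_
      rintro _ ⟨w, hw, rfl⟩
      change qdot e (rsmul w qj) = 0
      rw [qdot_rsmul, (hFmem hw).1, zero_mul]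
    have h4 := Submodule.finrank_sup_add_finrank_inf_eq F (F.map (rsmulL qj))
    rw [h2, finrank_bot, h1] at h4
    have h5 := Submodule.finrank_mono h3
    omega
  set s : Submodule ℝ (Matrix n n ℍ[ℝ]) :=
    g ⊓ LinearMap.ker (evalL e - lineL e ∘ₗ qdotL e ∘ₗ evalL e) with hs
  set im : ℍ[ℝ] →ₗ[ℝ] (Fin 3 → ℝ) :=
    { toFun := fun c => ![c.imI, c.imJ, c.imK]
      map_add' := fun c d => by ext i; fin_cases i <;> simp
      map_smul' := fun t c => by ext i; fin_cases i <;> simp } with him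
  have hsb : s ⊓ LinearMap.ker (im ∘ₗ qdotL e ∘ₗ evalL e) ≤ b := by
    rintro z ⟨⟨hz, hz'⟩, hz''⟩
    refine ⟨hz, ?_⟩
    have e1 : z *ᵥ e = rsmul e (qdot e (z *ᵥ e)) := sub_eq_zero.1 hz'
    have e2 : im (qdot e (z *ᵥ e)) = 0 := hz''
    have e3 := star_qdot_mulVec_self (hg.star_eq_neg z hz) e
    have e4 : qdot e (z *ᵥ e) = 0 := by
      have c1 := congrArg (fun x : ℍ[ℝ] => x.re) e3
      simp only [Quaternion.re_star, Quaternion.re_neg] at c1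
      ext
      · simp; linarith
      · exact congrFun e2 0
      · exact congrFun e2 1
      · exact congrFun e2 2
    rw [e4, rsmul_zero] at e1
    exact e1
  have hbF : b.map (evalL u) ≤ F := by
    rintro _ ⟨B, hB, rfl⟩
    refine ⟨?_, ?_⟩
    · change qdot e (B *ᵥ u) = 0
      rw [qdot_mulVec_of_skew (hg.star_eq_neg B hB.1), hbe hB, zero_qdot, neg_zero]
    · change y' *ᵥ (B *ᵥ u) - rsmul (B *ᵥ u) (r • qi) = 0
      rw [mulVec_mulVec, hcomm' hB, ← mulVec_mulVec, hyu, mulVec_rsmul, sub_self]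
  have hES : E ≤ s.map (evalL u) ⊔ LinearMap.range (lineL u) := by
    intro v hv
    have hv : qdot e v = 0 := hv
    obtain ⟨z, hz, a, c, hza, hzc⟩ := hg.exists_pair e u (v - rsmul u (qdot u v)) he hu heu
      (by rw [qdot_sub, hv, qdot_rsmul, heu, zero_mul, sub_zero])
      (by rw [qdot_sub, qdot_rsmul, hu, one_mul, sub_self])
    have h1 : v = z *ᵥ u + rsmul u (qdot u v - c) := by
      rw [hzc, rsmul_sub]; abel
    rw [h1]
    refine Submodule.add_mem_sup ⟨z, ⟨hz, ?_⟩, rfl⟩ ⟨_, rfl⟩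
    change z *ᵥ e - rsmul e (qdot e (z *ᵥ e)) = 0
    rw [hza, qdot_rsmul, he, one_mul, sub_self]
  have h1 := finrank_map_le_finrank_map_ker_add s (evalL u) (im ∘ₗ qdotL e ∘ₗ evalL e)
  have h2 := Submodule.finrank_mono ((Submodule.map_mono hsb).trans hbF)
  have h3 := (Submodule.finrank_mono hES).trans (Submodule.finrank_add_le_finrank_add_finrank _ _)
  have h4 := LinearMap.finrank_range_le (lineL u)
  have h5 : finrank ℝ E + 4 = _ := finrank_ker_qdotL he
  rw [Quaternion.finrank_eq_four] at h4
  rw [Module.finrank_fin_fun] at h1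
  omega

theorem eq_rsmul_of_forall (hg : IsLineTransitive g) (hn : 5 ≤ Fintype.card n) {e : n → ℍ[ℝ]}
    (he : qdot e e = 1) {ζ : n → ℍ[ℝ]} (hζ : ∀ x ∈ g, (qdot ζ (x *ᵥ e)).re = 0) :
    ζ = rsmul e (qdot e ζ) := by
  have hB {B : Matrix n n ℍ[ℝ]} (hB : B ∈ g) (hBe : B *ᵥ e = 0) : B *ᵥ ζ = 0 := by
    have hBs := hg.star_eq_neg B hB
    have h1 : qdot e (B *ᵥ ζ) = 0 := by
      rw [qdot_mulVec_of_skew hBs, hBe, zero_qdot, neg_zero]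
    obtain ⟨x, hx, a, hxa⟩ := hg.exists_line e (B *ᵥ ζ) he h1
    have h2 := hζ _ (hg.bracket_mem B hB x hx)
    rw [sub_mulVec, ← mulVec_mulVec, ← mulVec_mulVec, hBe, mulVec_zero, sub_zero,
      qdot_mulVec_of_skew hBs, hxa, qdot_add, qdot_rsmul, qdot_comm_eq_zero h1, zero_mul, add_zero,
      qdot_self, Quaternion.re_neg, Quaternion.re_coe, neg_eq_zero, nsq_eq_zero] at h2
    exact h2
  by_contra hne
  obtain ⟨r, u, hr, hu, hzu⟩ := exists_unit_smul (sub_ne_zero.2 hne)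
  have heu : qdot e u = 0 := by
    have h1 : qdot e (ζ - rsmul e (qdot e ζ)) = 0 := by
      rw [qdot_sub, qdot_rsmul, he, one_mul, sub_self]
    rw [hzu, qdot_smul] at h1
    exact (smul_eq_zero_iff_right hr.ne').1 h1
  have hBu {B : Matrix n n ℍ[ℝ]} (hB' : B ∈ g) (hBe : B *ᵥ e = 0) : B *ᵥ u = 0 := by
    have h1 : B *ᵥ (r • u) = 0 := by
      rw [← hzu, mulVec_sub, hB hB' hBe, mulVec_rsmul, hBe, zero_rsmul, sub_zero]
    have h2 : r • (B *ᵥ u) = 0 := by rw [← h1]; exact ((actL B).map_smul r u).symm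
    exact (smul_eq_zero_iff_right hr.ne').1 h2
  obtain ⟨w, hw0, hew, huw⟩ := exists_ne_zero_qdot_eq_zero (by omega) e u
  obtain ⟨x, hx, a, b, hxa, hxb⟩ := hg.exists_pair e u w he hu heu hew huw
  have h1 := hBu (g.sub_mem hx (hg.rk_mem hn he hx hxa))
    (by rw [sub_mulVec, hxa, rk_mulVec, he, mul_one, sub_self])
  rw [sub_mulVec, hxb, rk_mulVec, heu, mul_zero, rsmul_zero, sub_zero] at h1
  have h2 : qdot w (w + rsmul u b) = 0 := by rw [h1, qdot_zero]
  rw [qdot_add, qdot_rsmul, qdot_comm_eq_zero huw, zero_mul, add_zero, qdot_self_eq_zero] at h2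
  exact hw0 h2

theorem eq_zero_of_forall (hg : IsLineTransitive g) (hn : 5 ≤ Fintype.card n) {e : n → ℍ[ℝ]}
    (he : qdot e e = 1) {α : ℍ[ℝ]} (hα : star α = -α)
    (h : ∀ x ∈ g, (qdot (rsmul e α) (x *ᵥ e)).re = 0) : α = 0 := by
  by_contra hα0
  have hαre : α.re = 0 := by
    have c1 := congrArg (fun x : ℍ[ℝ] => x.re) hα
    simp only [Quaternion.re_star, Quaternion.re_neg] at c1
    linarith
  have hline (x : Matrix n n ℍ[ℝ]) (hx : x ∈ g) : ∃ c, x *ᵥ e = rsmul e c := by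
    have h1 : ∀ y ∈ g, (qdot (rsmul (x *ᵥ e) α) (y *ᵥ e)).re = 0 := by
      intro y hy
      have h2 := h _ (hg.bracket_mem x hx y hy)
      rw [sub_mulVec, ← mulVec_mulVec, ← mulVec_mulVec, rsmul_qdot, qdot_sub,
        qdot_mulVec_of_skew (hg.star_eq_neg x hx) e (y *ᵥ e),
        qdot_mulVec_of_skew (hg.star_eq_neg y hy) e (x *ᵥ e),
        ← star_qdot (x *ᵥ e) (y *ᵥ e), hα] at h2
      rw [rsmul_qdot, hα]
      simp only [Quaternion.re_mul, Quaternion.re_neg, Quaternion.imI_neg, Quaternion.imJ_neg,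
        Quaternion.imK_neg, Quaternion.re_sub, Quaternion.imI_sub, Quaternion.imJ_sub,
        Quaternion.imK_sub, Quaternion.re_star, Quaternion.imI_star, Quaternion.imJ_star,
        Quaternion.imK_star, hαre] at h2 ⊢
      linarith
    refine ⟨qdot e (rsmul (x *ᵥ e) α) * α⁻¹, ?_⟩
    rw [← rsmul_rsmul, ← hg.eq_rsmul_of_forall hn he h1, rsmul_rsmul, mul_inv_cancel₀ hα0,
      rsmul_one]
  obtain ⟨w, hw0, hew, -⟩ := exists_ne_zero_qdot_eq_zero (by omega) e e
  obtain ⟨x, hx, a, hxa⟩ := hg.exists_line e w he hew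
  obtain ⟨c, hc⟩ := hline x hx
  rw [hc] at hxa
  refine hw0 (qdot_self_eq_zero.1 ?_)
  have h1 : qdot w (rsmul e c) = qdot w (w + rsmul e a) := by rw [hxa]
  rw [qdot_add, qdot_rsmul, qdot_rsmul, qdot_comm_eq_zero hew, zero_mul, zero_mul, add_zero] at h1
  exact h1.symm

/-- A Lie algebra of skew-Hermitian matrices of size at least five that is transitive on lines and
on pairs of orthogonal lines contains every skew-Hermitian matrix. -/
theorem mem_of_skew (hg : IsLineTransitive g) (hn : 5 ≤ Fintype.card n) {X : Matrix n n ℍ[ℝ]}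
    (hX : star X = -X) : X ∈ g := by
  refine skew_mem_of_rk_mem (fun e he α hα => ?_) hX
  obtain ⟨ν, ⟨x, hx, rfl⟩, hperp⟩ := exists_mem_forall_bilin_sub_eq_zero (reDot n)
    reDot_isSymm (fun v hv => nsq_eq_zero.1 ((reDot_self v).symm.trans hv))
    (g.map (evalL e)) (rsmul e α)
  change ∀ z ∈ _, reDot n z (rsmul e α - x *ᵥ e) = 0 at hperp
  set ζ := rsmul e α - x *ᵥ e with hζ
  have hζ' : ∀ y ∈ g, (qdot ζ (y *ᵥ e)).re = 0 := fun y hy => by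
    rw [← star_qdot, Quaternion.re_star]
    exact hperp _ ⟨y, hy, rfl⟩
  set γ := qdot e ζ with hγ
  have hζγ : ζ = rsmul e γ := hg.eq_rsmul_of_forall hn he hζ'
  have him (c : ℍ[ℝ]) (hc : star c = -c) : c.re = 0 := by
    have c1 := congrArg (fun x : ℍ[ℝ] => x.re) hc
    simp only [Quaternion.re_star, Quaternion.re_neg] at c1
    linarith
  have hγs : star γ = -γ := by
    have h1 : γ = α - qdot e (x *ᵥ e) := by rw [hγ, hζ, qdot_sub, qdot_rsmul, he, one_mul]
    rw [h1, star_sub, hα, star_qdot_mulVec_self (hg.star_eq_neg x hx)]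
    abel
  have hγ0 : γ = 0 := hg.eq_zero_of_forall hn he hγs (hζγ ▸ hζ')
  rw [hγ0, rsmul_zero, hζ, sub_eq_zero] at hζγ
  exact hg.rk_mem hn he hx hζγ.symm

end IsLineTransitive

end TransitiveSubalgebra

section PairStabilizer

open Quaternion Matrix

set_option linter.unusedSectionVars false

variable {n : Type*} [Fintype n] [DecidableEq n]

/-- The projection onto a coordinate line. -/
noncomputable def lineProj (k : n) : Matrix n n ℍ[ℝ] := rk (Pi.single k 1) 1 (Pi.single k 1)

/-- The skew-Hermitian matrices preserving two given coordinate lines. -/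
noncomputable def pairStab (k l : n) : Submodule ℝ (Matrix n n ℍ[ℝ]) where
  carrier := {X | star X = -X ∧ X * lineProj k = lineProj k * X ∧ X * lineProj l = lineProj l * X}
  add_mem' := by
    rintro X Y ⟨hX, hX1, hX2⟩ ⟨hY, hY1, hY2⟩
    refine ⟨by rw [star_add, hX, hY]; abel, ?_, ?_⟩
    · rw [add_mul, mul_add, hX1, hY1]
    · rw [add_mul, mul_add, hX2, hY2]
  zero_mem' := by simp
  smul_mem' := by
    rintro r X ⟨hX, hX1, hX2⟩
    refine ⟨by rw [star_real_smul, hX, smul_neg], ?_, ?_⟩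
    · rw [smul_mul_assoc, hX1, mul_smul_comm]
    · rw [smul_mul_assoc, hX2, mul_smul_comm]

/-- The quaternionic unitary matrices preserving two given coordinate lines. -/
def pairStabGroup (k l : n) : Set (Matrix n n ℍ[ℝ]) :=
  {U | U ∈ SpSet n ∧ U * lineProj k = lineProj k * U ∧ U * lineProj l = lineProj l * U}

theorem mulVec_single_of_commute {X : Matrix n n ℍ[ℝ]} {k : n}
    (h : X * lineProj k = lineProj k * X) :
    ∃ a, X *ᵥ Pi.single k 1 = rsmul (Pi.single k 1) a := by
  refine ⟨1 * qdot (Pi.single k 1) (X *ᵥ Pi.single k 1), ?_⟩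
  have h1 := congrArg (· *ᵥ (Pi.single k 1 : n → ℍ[ℝ])) h
  simp only [← mulVec_mulVec, lineProj, rk_mulVec, qdot_single_self, mul_one, rsmul_one] at h1
  exact h1

theorem mem_pairStab_of_mulVec_eq_zero {X : Matrix n n ℍ[ℝ]} (hX : star X = -X) {k l : n}
    (hk : X *ᵥ Pi.single k 1 = 0) (hl : X *ᵥ Pi.single l 1 = 0) : X ∈ pairStab k l := by
  refine ⟨hX, ?_, ?_⟩
  · rw [lineProj, mul_rk, rk_mul, hX, neg_mulVec, hk, neg_zero, zero_rk, rk_zero_right]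
  · rw [lineProj, mul_rk, rk_mul, hX, neg_mulVec, hl, neg_zero, zero_rk, rk_zero_right]

theorem commute_star_of_mem_spSet {U P : Matrix n n ℍ[ℝ]} (hU : U ∈ SpSet n)
    (h : U * P = P * U) : star U * P = P * star U := by
  calc star U * P = star U * (P * U) * star U := by rw [mul_assoc, mul_assoc, hU.2, mul_one]
    _ = P * star U := by rw [← h, ← mul_assoc, hU.1, one_mul]

theorem pairStabGroup_isMatSubgroup (k l : n) : IsMatSubgroup (pairStabGroup k l) := by
  have hmul {a b P : Matrix n n ℍ[ℝ]} (ha : a * P = P * a) (hb : b * P = P * b) :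
      a * b * P = P * (a * b) := by rw [mul_assoc, hb, ← mul_assoc, ha, mul_assoc]
  refine ⟨⟨spSet_isMatSubgroup.1, by simp, by simp⟩, ?_, ?_⟩
  · rintro a ⟨ha, ha1, ha2⟩ b ⟨hb, hb1, hb2⟩
    exact ⟨mul_mem_spSet ha hb, hmul ha1 hb1, hmul ha2 hb2⟩
  · rintro a ⟨ha, ha1, ha2⟩
    exact ⟨star_mem_spSet ha, commute_star_of_mem_spSet ha ha1, commute_star_of_mem_spSet ha ha2⟩

theorem isClosed_pairStabGroup (k l : n) : IsClosed (pairStabGroup k l) :=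
  isClosed_spSet.inter ((isClosed_eq (by fun_prop) (by fun_prop)).inter
    (isClosed_eq (by fun_prop) (by fun_prop)))

theorem conj_mem_pairStab {k l : n} {U X : Matrix n n ℍ[ℝ]} (hU : U ∈ pairStabGroup k l)
    (hX : X ∈ pairStab k l) : U * X * star U ∈ pairStab k l := by
  have hmul {P : Matrix n n ℍ[ℝ]} (ha : U * P = P * U) (hb : X * P = P * X) :
      U * X * star U * P = P * (U * X * star U) := by
    rw [mul_assoc, commute_star_of_mem_spSet hU.1 ha, ← mul_assoc, mul_assoc U, hb, ← mul_assoc U,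
      ha]
    simp only [mul_assoc]
  refine ⟨?_, hmul hU.2.1 hX.2.1, hmul hU.2.2 hX.2.2⟩
  rw [star_mul, star_mul, star_star, hX.1, neg_mul, mul_neg, mul_assoc]

theorem isLineTransitive_of_forall_spSet {g : Submodule ℝ (Matrix n n ℍ[ℝ])}
    (hskew : ∀ X ∈ g, star X = -X) (hbr : ∀ X ∈ g, ∀ Y ∈ g, X * Y - Y * X ∈ g)
    (hn : 5 ≤ Fintype.card n) {k l : n} (hkl : k ≠ l)
    (h : ∀ U ∈ SpSet n, ∀ Z : Matrix n n ℍ[ℝ], star Z = -Z →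
      ∃ X ∈ g, ∃ Y ∈ pairStab k l, Z = X + U * Y * star U) : IsLineTransitive g := by
  have key {e u : n → ℍ[ℝ]} (he : qdot e e = 1) (hu : qdot u u = 1) (heu : qdot e u = 0)
      (Z : Matrix n n ℍ[ℝ]) (hZ : star Z = -Z) :
      ∃ X ∈ g, ∃ a b, X *ᵥ e = Z *ᵥ e + rsmul e a ∧ X *ᵥ u = Z *ᵥ u + rsmul u b := by
    obtain ⟨U, hU, hUe, hUu⟩ := exists_sp_mulVec_single he hu heu hkl
    obtain ⟨X, hX, Y, hY, hXY⟩ := h U hU Z hZ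
    obtain ⟨a, ha⟩ := mulVec_single_of_commute hY.2.1
    obtain ⟨b, hb⟩ := mulVec_single_of_commute hY.2.2
    have hconj {m : n} {c : ℍ[ℝ]} (hc : Y *ᵥ Pi.single m 1 = rsmul (Pi.single m 1) c) :
        (U * Y * star U) *ᵥ (U *ᵥ Pi.single m 1) = rsmul (U *ᵥ Pi.single m 1) c := by
      rw [mulVec_mulVec, mul_assoc, hU.1, mul_one, ← mulVec_mulVec, hc, mulVec_rsmul]
    refine ⟨X, hX, -a, -b, ?_, ?_⟩
    · rw [hXY, add_mulVec, ← hUe, hconj ha, rsmul_neg, add_neg_cancel_right]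
    · rw [hXY, add_mulVec, ← hUu, hconj hb, rsmul_neg, add_neg_cancel_right]
  refine ⟨hskew, hbr, fun e w he hew => ?_, fun e u w he hu heu hew huw => ?_⟩
  · obtain ⟨v, hv0, hev, -⟩ := exists_ne_zero_qdot_eq_zero (by omega) e e
    obtain ⟨r, u, hr, hu, rfl⟩ := exists_unit_smul hv0
    rw [qdot_smul] at hev
    obtain ⟨X, hX, a, -, hXa, -⟩ := key he hu ((smul_eq_zero_iff_right hr.ne').1 hev)
      (rk w 1 e - rk e 1 w) (by rw [star_sub, star_rk, star_rk, star_one, neg_sub])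
    refine ⟨X, hX, a, ?_⟩
    rw [hXa, sub_mulVec, rk_mulVec, rk_mulVec, he, qdot_comm_eq_zero hew]
    simp
  · obtain ⟨X, hX, a, b, hXa, hXb⟩ := key he hu heu
      (rk w 1 u - rk u 1 w) (by rw [star_sub, star_rk, star_rk, star_one, neg_sub])
    refine ⟨X, hX, a, b, ?_, ?_⟩
    · rw [hXa, sub_mulVec, rk_mulVec, rk_mulVec, qdot_comm_eq_zero heu, qdot_comm_eq_zero hew]
      simp
    · rw [hXb, sub_mulVec, rk_mulVec, rk_mulVec, hu, qdot_comm_eq_zero huw]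
      simp

theorem skew_mem_of_pairStab_le {S : Submodule ℝ (Matrix n n ℍ[ℝ])} {f : Fin 5 → n}
    (hf : Function.Injective f) (h : ∀ i j, i ≠ j → pairStab (f i) (f j) ≤ S)
    {X : Matrix n n ℍ[ℝ]} (hX : star X = -X) : X ∈ S := by
  have hmem (a b : n) (c : ℍ[ℝ]) : rk (Pi.single a 1) c (Pi.single b 1) -
      rk (Pi.single b 1) (star c) (Pi.single a 1) ∈ S := by
    obtain ⟨x, hx⟩ : ∃ x : Fin 5, ∀ i, i ≠ x → f i ≠ a := by
      by_cases ha : ∃ x, f x = a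
      · obtain ⟨x, rfl⟩ := ha
        exact ⟨x, fun i hi => hf.ne hi⟩
      · exact ⟨0, fun i _ hi => ha ⟨i, hi⟩⟩
    obtain ⟨y, hy⟩ : ∃ y : Fin 5, ∀ i, i ≠ y → f i ≠ b := by
      by_cases hb : ∃ y, f y = b
      · obtain ⟨y, rfl⟩ := hb
        exact ⟨y, fun i hi => hf.ne hi⟩
      · exact ⟨0, fun i _ hi => hb ⟨i, hi⟩⟩
    obtain ⟨i, j, hij, hix, hiy, hjx, hjy⟩ :
        ∃ i j : Fin 5, i ≠ j ∧ i ≠ x ∧ i ≠ y ∧ j ≠ x ∧ j ≠ y := by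
      have hdec : ∀ x y : Fin 5, ∃ i j : Fin 5, i ≠ j ∧ i ≠ x ∧ i ≠ y ∧ j ≠ x ∧ j ≠ y := by decide
      exact hdec x y
    have hz {m : n} (hma : m ≠ a) (hmb : m ≠ b) :
        (rk (Pi.single a 1) c (Pi.single b 1) -
          rk (Pi.single b 1) (star c) (Pi.single a 1)) *ᵥ Pi.single m 1 = 0 := by
      rw [sub_mulVec, rk_mulVec, rk_mulVec, qdot_single_single hma.symm,
        qdot_single_single hmb.symm]
      simp
    refine h i j hij (mem_pairStab_of_mulVec_eq_zero ?_ (hz (hx i hix) (hy i hiy))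
      (hz (hx j hjx) (hy j hjy)))
    rw [star_sub, star_rk, star_rk, star_star, neg_sub]
  have h2 : (2 : ℝ) • X ∈ S := by
    have : (2 : ℝ) • X = ∑ a, ∑ b, (rk (Pi.single a 1) (X a b) (Pi.single b 1) -
        rk (Pi.single b 1) (star (X a b)) (Pi.single a 1)) := by
      have h1 : star X = ∑ a, ∑ b, rk (Pi.single b 1) (star (X a b)) (Pi.single a 1) := by
        conv_lhs => rw [sum_rk_single X]
        simp only [star_sum, star_rk]
      simp only [Finset.sum_sub_distrib]
      rw [← sum_rk_single, ← h1, hX, sub_neg_eq_add, two_smul]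
    rw [this]
    exact S.sum_mem fun a _ => S.sum_mem fun b _ => hmem a b _
  simpa using S.smul_mem (2⁻¹ : ℝ) h2

theorem exists_pair_skew_mem_sup {g D : Submodule ℝ (Matrix n n ℍ[ℝ])}
    {f : Fin 5 → n} (hf : Function.Injective f)
    (hD : ∀ i j, i ≠ j → D ≤ pairStab (f i) (f j)) {v : Matrix n n ℍ[ℝ]}
    (h : ∀ X : Matrix n n ℍ[ℝ], star X = -X → X ∈ g ⊔ D ⊔ Submodule.span ℝ {v}) :
    ∃ k l : n, k ≠ l ∧ ∀ X : Matrix n n ℍ[ℝ], star X = -X → X ∈ g ⊔ pairStab k l := by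
  by_contra! hcon
  have hle (i j : Fin 5) (hij : i ≠ j) : pairStab (f i) (f j) ≤ g ⊔ D := by
    intro Y hY
    by_contra hYW
    obtain ⟨X, hX, hXn⟩ := hcon (f i) (f j) (hf.ne hij)
    have hWT : g ⊔ D ≤ g ⊔ pairStab (f i) (f j) := sup_le_sup_left (hD i j hij) g
    obtain ⟨w, hw, z, hz, hwz⟩ := Submodule.mem_sup.1 (h Y hY.1)
    obtain ⟨c, rfl⟩ := Submodule.mem_span_singleton.1 hz
    have hc : c ≠ 0 := by
      rintro rfl
      rw [zero_smul, add_zero] at hwz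
      exact hYW (hwz ▸ hw)
    have hv : v ∈ g ⊔ pairStab (f i) (f j) := by
      have : c • v ∈ g ⊔ pairStab (f i) (f j) := by
        rw [← add_sub_cancel_left w (c • v), hwz]
        exact Submodule.sub_mem _ (Submodule.mem_sup_right hY) (hWT hw)
      simpa [smul_smul, hc] using Submodule.smul_mem _ c⁻¹ this
    refine hXn (sup_le hWT ?_ (h X hX))
    rwa [Submodule.span_singleton_le_iff_mem]
  obtain ⟨X, hX, hXn⟩ := hcon (f 0) (f 1) (hf.ne (by decide))
  exact hXn (sup_le_sup_left (hD 0 1 (by decide)) g (skew_mem_of_pairStab_le hf hle hX))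

end PairStabilizer

section TransitiveGroup

open Quaternion Matrix NormedSpace

set_option linter.unusedSectionVars false

attribute [local instance] Matrix.linftyOpNormedRing Matrix.linftyOpNormedAlgebra
  hasContinuousStar_matrix hasStarModule_matrix

variable {n : Type*} [Fintype n] [DecidableEq n]

theorem isCompactUnitary_pairStabGroup (k l : n) : IsCompactUnitary (pairStabGroup k l) :=
  isCompactUnitary_of_subset_spSet (pairStabGroup_isMatSubgroup k l) (fun _ h => h.1)
    (isClosed_pairStabGroup k l)

theorem pairStab_le_lie (k l : n) : pairStab k l ≤ (isCompactUnitary_pairStabGroup k l).lie := by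
  intro X hX t
  have hc {P : Matrix n n ℍ[ℝ]} (h : X * P = P * X) : exp (t • X) * P = P * exp (t • X) :=
    ((show Commute X P from h).smul_left t).exp_left
  exact ⟨exp_mem_spSet hX.1 t, hc hX.2.1, hc hX.2.2⟩

/-- An invariant subalgebra `g` of the Lie algebra of a compact group of quaternionic unitary
matrices contains every skew-Hermitian matrix as soon as `g + D` has codimension at most one,
where `D` preserves five coordinate lines. -/
theorem skew_mem_of_codim_le_one {G : Set (Matrix n n ℍ[ℝ])} (hG : IsCompactUnitary G)
    (hn : 5 ≤ Fintype.card n) {g D : Submodule ℝ (Matrix n n ℍ[ℝ])} (hg : g ≤ hG.lie)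
    (hbr : ∀ X ∈ g, ∀ Y ∈ g, X * Y - Y * X ∈ g) (hconj : ∀ a ∈ G, ∀ X ∈ g, a * X * star a ∈ g)
    {f : Fin 5 → n} (hf : Function.Injective f)
    (hD : ∀ i j, i ≠ j → D ≤ pairStab (f i) (f j)) {v : Matrix n n ℍ[ℝ]}
    (h : ∀ X : Matrix n n ℍ[ℝ], star X = -X → X ∈ g ⊔ D ⊔ Submodule.span ℝ {v})
    {X : Matrix n n ℍ[ℝ]} (hX : star X = -X) : X ∈ g := by
  have hskew : ∀ X ∈ g, star X = -X := fun X hX => hG.star_eq_neg (hg hX)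
  obtain ⟨k, l, hkl, hsup⟩ := exists_pair_skew_mem_sup hf hD h
  have hH := isCompactUnitary_pairStabGroup k l
  have hmul := spSet_subset_mul hG hH fun X hX =>
    sup_le_sup hg (pairStab_le_lie k l) (hsup X hX)
  refine (isLineTransitive_of_forall_spSet hskew hbr hn hkl
    fun U hU Z hZ => ?_).mem_of_skew hn hX
  obtain ⟨a, ha, b, hb, rfl⟩ := Set.mem_mul.1 (hmul hU)
  have ha' := hG.subset_spSet ha
  have hZ' : star (star a * Z * a) = -(star a * Z * a) := by
    rw [star_mul, star_mul, star_star, hZ, neg_mul, mul_neg, mul_assoc]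
  obtain ⟨x, hx, y, hy, hxy⟩ := Submodule.mem_sup.1 (hsup _ hZ')
  refine ⟨a * x * star a, hconj a ha x hx, star b * y * star (star b),
    conj_mem_pairStab ((pairStabGroup_isMatSubgroup k l).2.2 b hb) hy, ?_⟩
  have h1 : a * b * (star b * y * star (star b)) * star (a * b) = a * y * star a := by
    calc _ = a * (b * star b) * y * (b * star b) * star a := by
          simp only [star_star, star_mul, mul_assoc]
      _ = _ := by rw [hb.1.2, mul_one, mul_one]
  rw [h1, ← add_mul, ← mul_add, hxy]
  calc Z = (a * star a) * Z * (a * star a) := by rw [ha'.2, one_mul, mul_one]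
    _ = _ := by simp only [mul_assoc]

end TransitiveGroup

section Simplicity

open Quaternion Matrix

set_option linter.unusedSectionVars false

variable {n : Type*} [Fintype n] [DecidableEq n]

theorem eq_imaginary_combination {a : ℍ[ℝ]} (ha : star a = -a) :
    a = a.imI • qi + a.imJ • qj + a.imK • qk := by
  have h := congrArg (fun x : ℍ[ℝ] => x.re) ha
  simp only [Quaternion.re_star, Quaternion.re_neg] at h
  ext
  · simp; linarith
  · simp
  · simp
  · simp

theorem star_sub_re (a : ℍ[ℝ]) : star (a - a.re • 1) = -(a - a.re • 1) := by
  ext <;> simp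

/-- The Lie algebra of skew-Hermitian quaternionic matrices is simple. -/
theorem skew_mem_of_ideal {I : Submodule ℝ (Matrix n n ℍ[ℝ])} (hskew : ∀ X ∈ I, star X = -X)
    (hI : ∀ Z : Matrix n n ℍ[ℝ], star Z = -Z → ∀ X ∈ I, Z * X - X * Z ∈ I) (hI0 : I ≠ ⊥)
    {X : Matrix n n ℍ[ℝ]} (hX : star X = -X) : X ∈ I := by
  obtain ⟨Y, hY, hY0⟩ := Submodule.exists_mem_ne_zero_of_ne_bot hI0
  obtain ⟨e, r, hr, he, hYe⟩ := exists_eigenvector_of_skew (hskew Y hY) hY0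
  have hrkskew (u : n → ℍ[ℝ]) {a : ℍ[ℝ]} (ha : star a = -a) : star (rk u a u) = -rk u a u := by
    rw [star_rk, ha, rk_neg]
  have hmem {a : ℍ[ℝ]} (ha : star a = -a) : rk e (r • (a * qi - qi * a)) e ∈ I := by
    have h1 := hI _ (hrkskew e ha) Y hY
    have h2 : rk e a e * Y - Y * rk e a e = rk e (r • (a * qi - qi * a)) e := by
      rw [rk_mul, mul_rk, hskew Y hY, neg_mulVec, hYe, rsmul_rk, ← rsmul_neg, rk_rsmul, ← rk_sub]
      congr 1
      rw [star_neg, Quaternion.star_smul, star_qi, smul_sub, smul_neg, neg_neg, mul_smul_comm,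
        smul_mul_assoc]
    rwa [h2] at h1
  have hscale {a b : ℍ[ℝ]} (t : ℝ) (h : rk e a e ∈ I) (hab : b = t • a) : rk e b e ∈ I := by
    rw [hab, rk_smul]
    exact I.smul_mem t h
  have hk : rk e qk e ∈ I := hscale (-(2 * r)⁻¹) (hmem star_qj) (by
    ext <;> simp; field_simp; norm_num)
  have hj : rk e qj e ∈ I := hscale ((2 * r)⁻¹) (hmem star_qk) (by
    ext <;> simp; field_simp; norm_num)
  have hi : rk e qi e ∈ I := by
    have h1 := hI _ (hrkskew e star_qj) _ hk
    rw [rk_mul_rk, rk_mul_rk, he, mul_one, mul_one, ← rk_sub] at h1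
    exact hscale 2⁻¹ h1 (by ext <;> simp; norm_num)
  have hE {a : ℍ[ℝ]} (ha : star a = -a) : rk e a e ∈ I := by
    rw [eq_imaginary_combination ha, rk_add, rk_add, rk_smul, rk_smul, rk_smul]
    exact I.add_mem (I.add_mem (I.smul_mem _ hi) (I.smul_mem _ hj)) (I.smul_mem _ hk)
  refine skew_mem_of_rk_mem (fun f hf a ha => ?_) hX
  set c := qdot e f with hc
  have hconj {d : ℍ[ℝ]} : star (d * a * star d) = -(d * a * star d) := by
    rw [star_mul, star_mul, star_star, ha, neg_mul, mul_neg, mul_assoc]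
  by_cases hz : f - rsmul e c = 0
  · rw [sub_eq_zero.1 hz, rk_rsmul, rsmul_rk, ← mul_assoc]
    exact hE hconj
  obtain ⟨s, u, hs, hu, hzu⟩ := exists_unit_smul hz
  have heu : qdot e u = 0 := by
    have h1 : qdot e (f - rsmul e c) = 0 := by
      rw [qdot_sub, qdot_rsmul, he, one_mul, sub_self]
    rw [hzu, qdot_smul] at h1
    exact (smul_eq_zero_iff_right hs.ne').1 h1
  have hue := qdot_comm_eq_zero heu
  have hZ : star (rk u 1 e - rk e 1 u) = -(rk u 1 e - rk e 1 u) := by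
    rw [star_sub, star_rk, star_rk, star_one, neg_sub]
  have hT {b : ℍ[ℝ]} (hb : star b = -b) : rk u b e + rk e b u ∈ I := by
    have h1 := hI _ hZ _ (hE hb)
    simp only [sub_mul, mul_sub, rk_mul_rk, he, heu, hue, mul_one, one_mul, mul_zero, zero_mul,
      rk_zero, sub_zero, zero_sub, sub_neg_eq_add] at h1
    exact h1
  have hU {b : ℍ[ℝ]} (hb : star b = -b) : rk u b u ∈ I := by
    have h1 := hI _ hZ _ (hT hb)
    simp only [sub_mul, mul_sub, add_mul, mul_add, rk_mul_rk, he, hu, heu, hue, mul_one, one_mul,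
      mul_zero, zero_mul, rk_zero, sub_zero, zero_sub, add_zero, zero_add] at h1
    have h2 : rk u b u = (2⁻¹ : ℝ) • (-rk e b e + rk u b u - (rk e b e - rk u b u)) + rk e b e := by
      module
    rw [h2]
    exact I.add_mem (I.smul_mem _ h1) (hE hb)
  have hR : rk e 1 u - rk u 1 e ∈ I := by
    have h1 := hI _ (hrkskew e star_qi) _ (hT star_qi)
    simp only [add_mul, mul_add, rk_mul_rk, he, heu, hue, mul_one, mul_zero, zero_mul,
      rk_zero, add_zero, zero_add, qi_mul_qi, rk_neg] at h1
    rw [sub_neg_eq_add, neg_add_eq_sub] at h1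
    simpa using I.neg_mem h1
  have hD (d : ℍ[ℝ]) : rk e d u - rk u (star d) e ∈ I := by
    have h1 : rk e d u - rk u (star d) e = d.re • (rk e 1 u - rk u 1 e) +
        (rk u (d - d.re • 1) e + rk e (d - d.re • 1) u) := by
      have h2 : star d = d.re • 1 - (d - d.re • 1) := by ext <;> simp
      rw [h2, rk_sub u, rk_smul _ u, rk_sub u, rk_smul _ u, rk_sub e, rk_smul _ e]
      module
    rw [h1]
    exact I.add_mem (I.smul_mem _ hR) (hT (star_sub_re d))
  have hfz : f = rsmul e c + s • u := by rw [← hzu]; abel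
  have hfin : rk f a f = rk e (c * a * star c) e + (s * s) • rk u a u +
      (rk e (s • (c * a)) u - rk u (star (s • (c * a))) e) := by
    rw [hfz, add_rk, rk_add_right, rk_add_right, rk_rsmul, rk_rsmul, rsmul_rk, rsmul_rk,
      rk_smul_right, rk_smul_right, smul_rk, smul_rk, Quaternion.star_smul, star_mul, ha, rk_smul,
      rk_smul,
      neg_mul, rk_neg, mul_assoc, smul_smul]
    module
  rw [hfin]
  exact I.add_mem (I.add_mem (hE hconj) (I.smul_mem _ (hU ha))) (hD _)

end Simplicity

section Tangent

open Quaternion Matrix NormedSpace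

set_option linter.unusedSectionVars false

attribute [local instance] Matrix.linftyOpNormedRing Matrix.linftyOpNormedAlgebra
  hasContinuousStar_matrix hasStarModule_matrix

theorem Submodule.exists_le_sup_span_of_finrank_le {V : Type*} [AddCommGroup V] [Module ℝ V]
    [FiniteDimensional ℝ V] {S T : Submodule ℝ V} (hST : S ≤ T)
    (h : finrank ℝ T ≤ finrank ℝ S + 1) : ∃ v, T ≤ S ⊔ Submodule.span ℝ {v} := by
  by_cases hTS : T ≤ S
  · exact ⟨0, hTS.trans le_sup_left⟩
  obtain ⟨v, hvT, hvS⟩ := Set.not_subset.1 hTS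
  have hle : S ⊔ Submodule.span ℝ {v} ≤ T :=
    sup_le hST ((Submodule.span_singleton_le_iff_mem _ _).2 hvT)
  have hlt : S < S ⊔ Submodule.span ℝ {v} := by
    refine lt_of_le_not_ge le_sup_left fun h1 => hvS (h1 ?_)
    exact Submodule.mem_sup_right (Submodule.mem_span_singleton_self v)
  have := Submodule.finrank_lt_finrank_of_lt hlt
  exact ⟨v, (Submodule.eq_of_le_of_finrank_le hle (by omega)).ge⟩

theorem Submodule.finrank_le_of_map_le {V W : Type*} [AddCommGroup V] [Module ℝ V]
    [AddCommGroup W] [Module ℝ W] [FiniteDimensional ℝ W] {S : Submodule ℝ V}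
    {T : Submodule ℝ W} (f : V →ₗ[ℝ] W) (hST : ∀ x ∈ S, f x ∈ T)
    (hinj : ∀ x ∈ S, f x = 0 → x = 0) : finrank ℝ S ≤ finrank ℝ T := by
  refine LinearMap.finrank_le_finrank_of_injective (f := f.restrict hST) ?_
  refine (injective_iff_map_eq_zero _).2 fun x hx => Subtype.ext (hinj x x.2 ?_)
  simpa using congrArg Subtype.val hx

variable {n : Type*} [Fintype n] [DecidableEq n] {G H K : Set (Matrix n n ℍ[ℝ])}

theorem matTangentAt_mono {S T : Set (Matrix n n ℍ[ℝ])} (h : S ⊆ T) (x : Matrix n n ℍ[ℝ]) :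
    matTangentAt S x ≤ matTangentAt T x :=
  Submodule.span_mono fun _ ⟨c, hc, h0, hd⟩ => ⟨c, fun t => h (hc t), h0, hd⟩

theorem mem_matTangentAt_one {X : Matrix n n ℍ[ℝ]} (h : ∀ t : ℝ, exp (t • X) ∈ K) :
    X ∈ matTangentAt K 1 :=
  Submodule.subset_span ⟨fun t => exp (t • X), h, by simp, fun i j =>
    hasDerivAt_pi.1 (hasDerivAt_pi.1 (hasDerivAt_exp_smul_zero X) i) j⟩

theorem mul_comm_of_mem_lie (hG : IsCompactUnitary G) {P X : Matrix n n ℍ[ℝ]}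
    (hP : ∀ g ∈ G, g * P = P * g) (hX : X ∈ hG.lie) : X * P = P * X := by
  have h1 := (hasDerivAt_exp_smul_zero X).mul_const P
  have h2 := (hasDerivAt_exp_smul_zero X).const_mul P
  exact h1.unique (h2.congr_of_eventuallyEq (.of_forall fun t => hP _ (hX t)))

theorem isCompactUnitary_conj (hG : IsCompactUnitary G) {k : Matrix n n ℍ[ℝ]}
    (hk : k ∈ SpSet n) : IsCompactUnitary {x | k * x * star k ∈ G} := by
  have hsub : {x | k * x * star k ∈ G} ⊆ SpSet n := fun x hx => by
    have h1 := mul_mem_spSet (mul_mem_spSet (star_mem_spSet hk) (hG.subset_spSet hx)) hk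
    have h2 : star k * (k * x * star k) * k = x := by
      calc _ = (star k * k) * x * (star k * k) := by simp only [mul_assoc]
        _ = x := by rw [hk.1, one_mul, mul_one]
    rwa [h2] at h1
  refine isCompactUnitary_of_subset_spSet ⟨?_, fun a ha b hb => ?_, fun a ha => ?_⟩ hsub ?_
  · simpa [hk.2] using hG.one_mem
  · have h1 := hG.mul_mem _ ha _ hb
    have h2 : k * a * star k * (k * b * star k) = k * (a * b) * star k := by
      calc _ = k * a * (star k * k) * b * star k := by simp only [mul_assoc]
        _ = _ := by rw [hk.1, mul_one, mul_assoc k a b]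
    rwa [h2] at h1
  · have h1 := hG.star_mem _ ha
    rwa [star_mul, star_mul, star_star, ← mul_assoc] at h1
  · exact hG.isCompact.isClosed.preimage (by fun_prop)

theorem finrank_matTangentAt_lrOrbit_le (hG : IsCompactUnitary G) (hH : IsCompactUnitary H)
    {k : Matrix n n ℍ[ℝ]} (hk : k ∈ SpSet n) :
    finrank ℝ (matTangentAt (lrOrbit G H k) k) ≤
      finrank ℝ ((isCompactUnitary_conj hG hk).lie ⊔ hH.lie : Submodule ℝ (Matrix n n ℍ[ℝ])) := by
  set g := (isCompactUnitary_conj hG hk).lie with hg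
  have hle : matTangentAt (lrOrbit G H k) k ≤ (g ⊔ hH.lie).map (LinearMap.mulLeft ℝ k) := by
    refine Submodule.span_le.2 ?_
    rintro w ⟨c, hc, h0, hd⟩
    have hw : HasDerivAt c w 0 := hasDerivAt_pi.2 fun i => hasDerivAt_pi.2 fun j => hd i j
    obtain ⟨X, hX, Y, hY, rfl⟩ :=
      exists_lie_of_hasDerivAt_orbit isTraceForm_reTrace hG hH hk.1 hk.2 hc h0 hw
    refine ⟨star k * X * k - Y, Submodule.sub_mem _ (Submodule.mem_sup_left ?_)
      (Submodule.mem_sup_right hY), ?_⟩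
    · refine (isCompactUnitary_conj hG hk).forall_exp_mem_of_hasDerivAt
        (c := fun t => star k * exp (t • X) * k) (fun t => ?_) (by simp [hk.1])
        (((hasDerivAt_exp_smul_zero X).const_mul _).mul_const _)
      have h1 : k * (star k * exp (t • X) * k) * star k = exp (t • X) := by
        calc _ = (k * star k) * exp (t • X) * (k * star k) := by simp only [mul_assoc]
          _ = _ := by rw [hk.2, one_mul, mul_one]
      change k * (star k * exp (t • X) * k) * star k ∈ G
      rw [h1]
      exact hX t
    · rw [LinearMap.mulLeft_apply, mul_sub, ← mul_assoc, ← mul_assoc, hk.2, one_mul]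
  exact (Submodule.finrank_mono hle).trans (Submodule.finrank_map_le _ _)

/-- If `G × H` acts on `K` with cohomogeneity at most one, then the Lie algebras of some conjugate
of `G` and of `H` span a subspace of codimension at most one. -/
theorem exists_mem_sup_lie_of_lrCohomogeneity_le_one (hG : IsCompactUnitary G)
    (hH : IsCompactUnitary H) (hK : IsMatSubgroup K) (hKsub : K ⊆ SpSet n) (hGK : G ⊆ K)
    (hHK : H ⊆ K) {H₀ : Set (Matrix n n ℍ[ℝ])} (hH₀ : H₀ ⊆ H) (h : lrCohomogeneity G H₀ K ≤ 1) :
    ∃ k, ∃ hk : k ∈ K, ∃ v, ∀ X : Matrix n n ℍ[ℝ], (∀ t : ℝ, exp (t • X) ∈ K) →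
      X ∈ (isCompactUnitary_conj hG (hKsub hk)).lie ⊔ hH.lie ⊔ Submodule.span ℝ {v} := by
  have hbdd : BddAbove (Set.range fun k : K =>
      finrank ℝ (matTangentAt (lrOrbit G H₀ k) (k : Matrix n n ℍ[ℝ]))) := by
    refine ⟨finrank ℝ (Matrix n n ℍ[ℝ]), ?_⟩
    rintro _ ⟨k, rfl⟩
    exact Submodule.finrank_le _
  have : Nonempty K := ⟨⟨1, hK.1⟩⟩
  obtain ⟨⟨k, hk⟩, hkmax⟩ := Nat.sSup_mem (Set.range_nonempty _) hbdd
  refine ⟨k, hk, ?_⟩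
  have hGK' {x : Matrix n n ℍ[ℝ]} (hx : k * x * star k ∈ G) : x ∈ K := by
    have h1 := hK.2.1 _ (hK.2.1 _ (hK.2.2 _ hk) _ (hGK hx)) _ hk
    have h2 : star k * (k * x * star k) * k = x := by
      calc _ = (star k * k) * x * (star k * k) := by simp only [mul_assoc]
        _ = _ := by rw [(hKsub hk).1, one_mul, mul_one]
    rwa [h2] at h1
  have hle : (isCompactUnitary_conj hG (hKsub hk)).lie ⊔ hH.lie ≤ matTangentAt K 1 :=
    sup_le (fun X hX => mem_matTangentAt_one fun t => hGK' (hX t))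
      fun X hX => mem_matTangentAt_one fun t => hHK (hX t)
  have hfin : finrank ℝ (matTangentAt K 1) ≤ finrank ℝ
      ((isCompactUnitary_conj hG (hKsub hk)).lie ⊔ hH.lie : Submodule ℝ (Matrix n n ℍ[ℝ])) + 1 := by
    have h1 : finrank ℝ (matTangentAt (lrOrbit G H₀ k) k) ≤
        finrank ℝ (matTangentAt (lrOrbit G H k) k) :=
      Submodule.finrank_mono (matTangentAt_mono (by
        rintro x ⟨g, hg, h, hh, hx⟩
        exact ⟨g, hg, h, hH₀ hh, hx⟩) k)
    have h2 := finrank_matTangentAt_lrOrbit_le hG hH (hKsub hk)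
    rw [lrCohomogeneity, grpDim, iSup, ← hkmax] at h
    dsimp only at h
    omega
  obtain ⟨v, hv⟩ := Submodule.exists_le_sup_span_of_finrank_le hle hfin
  exact ⟨v, fun X hX => hv (mem_matTangentAt_one hX)⟩

end Tangent

section Blocks

open Quaternion Matrix NormedSpace

set_option linter.unusedSectionVars false

attribute [local instance] Matrix.linftyOpNormedRing Matrix.linftyOpNormedAlgebra
  hasContinuousStar_matrix hasStarModule_matrix

variable {m n : Type*} [Fintype m] [DecidableEq m] [Fintype n] [DecidableEq n]

theorem commute_rk_single_iff {X : Matrix n n ℍ[ℝ]} {a b : n} :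
    X * rk (Pi.single a 1) 1 (Pi.single b 1) = rk (Pi.single a 1) 1 (Pi.single b 1) * X ↔
      (∀ i ≠ a, X i a = 0) ∧ (∀ j ≠ b, X b j = 0) ∧ X a a = X b b := by
  have hl (i j : n) : (X * rk (Pi.single a 1) 1 (Pi.single b 1)) i j =
      if j = b then X i a else 0 := by
    rw [mul_rk, mulVec_single_eq]
    by_cases h : j = b <;> simp [rk, Pi.single_apply, h]
  have hr (i j : n) : (rk (Pi.single a 1) 1 (Pi.single b 1) * X) i j =
      if i = a then X b j else 0 := by
    rw [rk_mul, mulVec_single_eq]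
    by_cases h : i = a <;> simp [rk, Pi.single_apply, h, Matrix.star_apply]
  constructor
  · intro h
    have h1 (i j : n) : (if j = b then X i a else 0) = if i = a then X b j else 0 := by
      rw [← hl, ← hr, h]
    refine ⟨fun i hi => ?_, fun j hj => ?_, ?_⟩
    · simpa [hi] using h1 i b
    · simpa [hj] using (h1 a j).symm
    · simpa using h1 a b
  · rintro ⟨h1, h2, h3⟩
    ext1 i j
    rw [hl, hr]
    by_cases hi : i = a <;> by_cases hj : j = b
    · simp [hi, hj, h3]
    · simp [hi, hj, h2 j hj]
    · simp [hi, hj, h1 i hi]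
    · simp [hi, hj]

/-- The restriction of a matrix to a block of coordinates. -/
def blockL (σ : m → n) : Matrix n n ℍ[ℝ] →ₗ[ℝ] Matrix m m ℍ[ℝ] where
  toFun X := X.submatrix σ σ
  map_add' _ _ := rfl
  map_smul' _ _ := rfl

theorem blockL_apply (σ : m → n) (X : Matrix n n ℍ[ℝ]) (i j : m) :
    blockL σ X i j = X (σ i) (σ j) := rfl

theorem blockL_star (σ : m → n) (X : Matrix n n ℍ[ℝ]) : blockL σ (star X) = star (blockL σ X) := by
  ext1 i j; simp only [blockL_apply, Matrix.star_apply]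

theorem blockL_one {σ : m → n} (hσ : Function.Injective σ) : blockL σ 1 = 1 := by
  ext1 i j; simp only [blockL_apply, Matrix.one_apply, hσ.eq_iff]

theorem blockL_mul {σ : m → n} (hσ : Function.Injective σ) {X : Matrix n n ℍ[ℝ]}
    (hX : ∀ i, ∀ k ∉ Set.range σ, X (σ i) k = 0) (Y : Matrix n n ℍ[ℝ]) :
    blockL σ (X * Y) = blockL σ X * blockL σ Y := by
  ext1 i j
  simp only [blockL_apply, Matrix.mul_apply]
  exact (Fintype.sum_of_injective σ hσ _ _
    (fun k hk => by rw [hX i k hk, zero_mul]) fun k => rfl).symm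

theorem isCompactUnitary_image_blockL {G : Set (Matrix n n ℍ[ℝ])} (hG : IsCompactUnitary G)
    {σ : m → n} (hσ : Function.Injective σ)
    (hGσ : ∀ g ∈ G, ∀ i, ∀ k ∉ Set.range σ, g (σ i) k = 0) :
    IsCompactUnitary (blockL σ '' G) where
  one_mem := ⟨1, hG.one_mem, blockL_one hσ⟩
  mul_mem := by
    rintro _ ⟨a, ha, rfl⟩ _ ⟨b, hb, rfl⟩
    exact ⟨a * b, hG.mul_mem a ha b hb, blockL_mul hσ (hGσ a ha) b⟩
  star_mem := by
    rintro _ ⟨a, ha, rfl⟩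
    exact ⟨star a, hG.star_mem a ha, blockL_star σ a⟩
  star_mul_self := by
    rintro _ ⟨a, ha, rfl⟩
    rw [← blockL_star, ← blockL_mul hσ (hGσ _ (hG.star_mem a ha)), hG.star_mul_self a ha,
      blockL_one hσ]
  isCompact := hG.isCompact.image (blockL σ).continuous_of_finiteDimensional

theorem blockL_mem_pairStab {σ : m → n} (hσ : Function.Injective σ) {k l : m}
    {X : Matrix n n ℍ[ℝ]} (hX : X ∈ pairStab (σ k) (σ l)) : blockL σ X ∈ pairStab k l := by
  have h1 (k : m) (hk : X * lineProj (σ k) = lineProj (σ k) * X) :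
      blockL σ X * lineProj k = lineProj k * blockL σ X := by
    obtain ⟨h1, h2, -⟩ := commute_rk_single_iff.1 hk
    exact commute_rk_single_iff.2
      ⟨fun i hi => h1 _ (hσ.ne hi), fun j hj => h2 _ (hσ.ne hj), rfl⟩
  exact ⟨by rw [← blockL_star, hX.1, map_neg], h1 k hX.2.1, h1 l hX.2.2⟩

/-- If the Lie algebra of a compact group respecting a block of coordinates projects onto the
skew-Hermitian matrices of that block up to codimension one and a subspace `D` preserving five
coordinate lines, then it projects onto all skew-Hermitian matrices of the block. -/
theorem exists_mem_lie_blockL_eq {G : Set (Matrix n n ℍ[ℝ])} (hG : IsCompactUnitary G)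
    {σ : m → n} (hσ : Function.Injective σ)
    (hGσ : ∀ g ∈ G, ∀ i, ∀ k ∉ Set.range σ, g (σ i) k = 0) (hm : 5 ≤ Fintype.card m)
    {D : Submodule ℝ (Matrix n n ℍ[ℝ])} {f : Fin 5 → m} (hf : Function.Injective f)
    (hD : ∀ i j, i ≠ j → D ≤ pairStab (σ (f i)) (σ (f j))) {v : Matrix n n ℍ[ℝ]}
    (h : ∀ X : Matrix m m ℍ[ℝ], star X = -X →
      ∃ Y ∈ hG.lie ⊔ D ⊔ Submodule.span ℝ {v}, blockL σ Y = X)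
    {X : Matrix m m ℍ[ℝ]} (hX : star X = -X) : ∃ Y ∈ hG.lie, blockL σ Y = X := by
  have hS := isCompactUnitary_image_blockL hG hσ hGσ
  have hlie {Y : Matrix n n ℍ[ℝ]} (hY : Y ∈ hG.lie) : ∀ i, ∀ k ∉ Set.range σ, Y (σ i) k = 0 := by
    intro i k hk
    have h1 := hasDerivAt_pi.1 (hasDerivAt_pi.1 (hasDerivAt_exp_smul_zero Y) (σ i)) k
    exact h1.unique ((hasDerivAt_const (0 : ℝ) (0 : ℍ[ℝ])).congr_of_eventuallyEq
      (.of_forall fun t => hGσ _ (hY t) i k hk))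
  refine skew_mem_of_codim_le_one (g := hG.lie.map (blockL σ)) (D := D.map (blockL σ))
    (v := blockL σ v) hS hm ?_ ?_ ?_ hf ?_ ?_ hX
  · rintro _ ⟨Y, hY, rfl⟩
    refine hS.forall_exp_mem_of_hasDerivAt (c := fun t => blockL σ (exp (t • Y)))
      (fun t => ⟨_, hY t, rfl⟩) (by simp [blockL_one hσ]) ?_
    exact (LinearMap.toContinuousLinearMap (blockL σ)).hasFDerivAt.comp_hasDerivAt (0 : ℝ)
      (hasDerivAt_exp_smul_zero Y)
  · rintro _ ⟨Y, hY, rfl⟩ _ ⟨Z, hZ, rfl⟩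
    refine ⟨Y * Z - Z * Y, hG.bracket_mem hY hZ, ?_⟩
    rw [map_sub, blockL_mul hσ (hlie hY), blockL_mul hσ (hlie hZ)]
  · rintro _ ⟨a, ha, rfl⟩ _ ⟨Y, hY, rfl⟩
    refine ⟨a * Y * star a, hG.conj_mem ha hY, ?_⟩
    rw [mul_assoc, blockL_mul hσ (hGσ a ha), blockL_mul hσ (hlie hY), blockL_star, mul_assoc]
  · rintro i j hij _ ⟨Y, hY, rfl⟩
    exact blockL_mem_pairStab hσ (hD i j hij hY)
  · intro X hX
    obtain ⟨Y, hY, rfl⟩ := h X hX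
    have := Submodule.mem_map_of_mem (f := blockL σ) hY
    rwa [Submodule.map_sup, Submodule.map_sup, Submodule.map_span, Set.image_singleton] at this

end Blocks

section SymplecticPair

open Quaternion Matrix NormedSpace

set_option linter.unusedSectionVars false

attribute [local instance] Matrix.linftyOpNormedRing Matrix.linftyOpNormedAlgebra
  hasContinuousStar_matrix hasStarModule_matrix

section Generic

variable {n : Type*} [Fintype n] [DecidableEq n]

/-- The space of skew-Hermitian quaternionic matrices. -/
def skewHerm (n : Type*) [Fintype n] [DecidableEq n] : Submodule ℝ (Matrix n n ℍ[ℝ]) where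
  carrier := {X | star X = -X}
  add_mem' {X Y} hX hY := by
    change star (X + Y) = -(X + Y)
    rw [star_add, show star X = -X from hX, show star Y = -Y from hY, neg_add]
  zero_mem' := by simp
  smul_mem' r X hX := by
    change star (r • X) = -(r • X)
    rw [star_real_smul, show star X = -X from hX, smul_neg]

theorem mem_skewHerm {X : Matrix n n ℍ[ℝ]} : X ∈ skewHerm n ↔ star X = -X := Iff.rfl

theorem finrank_add_four_le {D : Submodule ℝ (Matrix n n ℍ[ℝ])} {k l : n} (hkl : k ≠ l)
    (hD : D ≤ skewHerm n) (hDk : ∀ X ∈ D, X * lineProj k = lineProj k * X) :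
    finrank ℝ D + 4 ≤ finrank ℝ (skewHerm n) := by
  let B : ℍ[ℝ] →ₗ[ℝ] Matrix n n ℍ[ℝ] :=
    { toFun c := rk (Pi.single k 1) c (Pi.single l 1) - rk (Pi.single l 1) (star c) (Pi.single k 1)
      map_add' c d := by simp only [star_add, rk_add]; abel
      map_smul' r c := by simp only [Quaternion.star_smul, rk_smul, RingHom.id_apply, smul_sub] }
  have hBkl (c : ℍ[ℝ]) : B c k l = c := by
    change rk (Pi.single k 1) c (Pi.single l 1) k l
      - rk (Pi.single l 1) (star c) (Pi.single k 1) k l = c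
    simp [rk, hkl]
  have hBs (c : ℍ[ℝ]) : B c ∈ skewHerm n := by
    change star (rk (Pi.single k 1) c (Pi.single l 1) - rk (Pi.single l 1) (star c) (Pi.single k 1))
      = -(rk (Pi.single k 1) c (Pi.single l 1) - rk (Pi.single l 1) (star c) (Pi.single k 1))
    rw [star_sub, star_rk, star_rk, star_star, neg_sub]
  have hBinj : Function.Injective B := fun c d h => by rw [← hBkl c, h, hBkl]
  have hinf : D ⊓ B.range = ⊥ := by
    refine (Submodule.eq_bot_iff _).2 ?_
    rintro _ ⟨hX, c, rfl⟩
    have h1 := (commute_rk_single_iff.1 (hDk _ hX)).2.1 l hkl.symm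
    rw [hBkl] at h1
    rw [h1, map_zero]
  have h1 := Submodule.finrank_sup_add_finrank_inf_eq D B.range
  rw [hinf, finrank_bot, LinearMap.finrank_range_of_inj hBinj, Quaternion.finrank_eq_four] at h1
  have h2 : D ⊔ B.range ≤ skewHerm n := by
    refine sup_le hD ?_
    rintro _ ⟨c, rfl⟩
    exact hBs c
  have h3 := Submodule.finrank_mono h2
  omega

/-- The quaternionic unitary matrices commuting with every matrix in `S`. -/
def unitaryCentralizer (S : Set (Matrix n n ℍ[ℝ])) : Set (Matrix n n ℍ[ℝ]) :=
  {U | U ∈ SpSet n ∧ ∀ P ∈ S, U * P = P * U}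

theorem unitaryCentralizer_isMatSubgroup (S : Set (Matrix n n ℍ[ℝ])) :
    IsMatSubgroup (unitaryCentralizer S) := by
  refine ⟨⟨spSet_isMatSubgroup.1, by simp⟩, ?_, ?_⟩
  · rintro a ⟨ha, ha'⟩ b ⟨hb, hb'⟩
    exact ⟨mul_mem_spSet ha hb, fun P hP => by
      rw [mul_assoc, hb' P hP, ← mul_assoc, ha' P hP, mul_assoc]⟩
  · rintro a ⟨ha, ha'⟩
    exact ⟨star_mem_spSet ha, fun P hP => commute_star_of_mem_spSet ha (ha' P hP)⟩

theorem isCompactUnitary_unitaryCentralizer (S : Set (Matrix n n ℍ[ℝ])) :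
    IsCompactUnitary (unitaryCentralizer S) := by
  refine isCompactUnitary_of_subset_spSet (unitaryCentralizer_isMatSubgroup S) (fun _ h => h.1) ?_
  have : unitaryCentralizer S = SpSet n ∩ ⋂ P ∈ S, {U | U * P = P * U} := by
    ext U; simp [unitaryCentralizer]
  rw [this]
  exact isClosed_spSet.inter (isClosed_biInter fun P _ => isClosed_eq (by fun_prop) (by fun_prop))

theorem exp_mem_unitaryCentralizer {S : Set (Matrix n n ℍ[ℝ])} {X : Matrix n n ℍ[ℝ]}
    (hX : star X = -X) (hXS : ∀ P ∈ S, X * P = P * X) (t : ℝ) :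
    exp (t • X) ∈ unitaryCentralizer S :=
  ⟨exp_mem_spSet hX t, fun P hP => ((show Commute X P from hXS P hP).smul_left t).exp_left⟩

end Generic

variable {p q : ℕ}

/-- The projection of `ℍ^p ⊕ ℍ^q` onto `ℍ^p`. -/
noncomputable def inlProj (p q : ℕ) : Matrix (Fin p ⊕ Fin q) (Fin p ⊕ Fin q) ℍ[ℝ] :=
  fromBlocks 1 0 0 0

theorem commute_inlProj_iff {X : Matrix (Fin p ⊕ Fin q) (Fin p ⊕ Fin q) ℍ[ℝ]} :
    X * inlProj p q = inlProj p q * X ↔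
      ∀ (i : Fin p) (j : Fin q), X (Sum.inl i) (Sum.inr j) = 0 ∧ X (Sum.inr j) (Sum.inl i) = 0 := by
  rw [← fromBlocks_toBlocks X, inlProj, fromBlocks_multiply, fromBlocks_multiply, fromBlocks_inj]
  simp only [Matrix.mul_one, Matrix.mul_zero, add_zero, Matrix.one_mul, Matrix.zero_mul, true_and,
    and_true]
  constructor
  · rintro ⟨h1, h2⟩ i j
    exact ⟨(congrFun (congrFun h1 i) j).symm, congrFun (congrFun h2 j) i⟩
  · intro h
    constructor
    · ext1 i j; exact (h i j).1.symm
    · ext1 j i; exact (h i j).2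

theorem spPairSet_eq : SpPairSet p q = unitaryCentralizer {inlProj p q} := by
  ext A
  simp only [SpPairSet, unitaryCentralizer, SpSet, Set.mem_ofPred_eq, Set.mem_singleton_iff,
    forall_eq, commute_inlProj_iff, and_assoc]

/-- The rank one matrix sending the `i`-th coordinate of `ℍ^q` to that of `ℍ^p`. -/
noncomputable def transfer (hqp : q ≤ p) (i : Fin q) :
    Matrix (Fin p ⊕ Fin q) (Fin p ⊕ Fin q) ℍ[ℝ] :=
  rk (Pi.single (Sum.inl (Fin.castLE hqp i)) 1) 1 (Pi.single (Sum.inr i) 1)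

theorem spPrincipalIsotropy_subset (hqp : q ≤ p) : SpPrincipalIsotropy p q hqp ⊆
    unitaryCentralizer (insert (inlProj p q) (Set.range (transfer hqp))) := by
  rintro A ⟨hA, h1, h2, h3, h4⟩
  have hA' := hA
  rw [spPairSet_eq] at hA'
  refine ⟨hA'.1, ?_⟩
  rintro P (rfl | ⟨i, rfl⟩)
  · exact hA'.2 _ rfl
  refine commute_rk_single_iff.2 ⟨?_, ?_, (h4 i).symm⟩
  · rintro (j | j) hj
    · rcases lt_or_ge (j : ℕ) q with hjq | hjq
      · exact h1 j hjq _ hj.symm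
      · exact h2 j hjq _ i.isLt
    · exact (hA.2.2 _ _).2
  · rintro (j | j) hj
    · exact (hA.2.2 _ _).2
    · exact h3 i j fun h => hj (congrArg _ h.symm)

/-- The inclusion of matrices acting on `ℍ^p` as block matrices. -/
noncomputable def inlEmbed (p q : ℕ) :
    Matrix (Fin p) (Fin p) ℍ[ℝ] →ₗ[ℝ] Matrix (Fin p ⊕ Fin q) (Fin p ⊕ Fin q) ℍ[ℝ] where
  toFun X := fromBlocks X 0 0 0
  map_add' X Y := by simp [fromBlocks_add]
  map_smul' r X := by simp [fromBlocks_smul]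

/-- The inclusion of matrices acting on `ℍ^q` as block matrices. -/
noncomputable def inrEmbed (p q : ℕ) :
    Matrix (Fin q) (Fin q) ℍ[ℝ] →ₗ[ℝ] Matrix (Fin p ⊕ Fin q) (Fin p ⊕ Fin q) ℍ[ℝ] where
  toFun X := fromBlocks 0 0 0 X
  map_add' X Y := by simp [fromBlocks_add]
  map_smul' r X := by simp [fromBlocks_smul]

theorem eq_fromBlocks {X : Matrix (Fin p ⊕ Fin q) (Fin p ⊕ Fin q) ℍ[ℝ]}
    (hX : X * inlProj p q = inlProj p q * X) :
    X = fromBlocks (blockL Sum.inl X) 0 0 (blockL Sum.inr X) := by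
  rw [commute_inlProj_iff] at hX
  ext1 (i | i) (j | j)
  · rfl
  · exact (hX _ _).1
  · exact (hX _ _).2
  · rfl

theorem fromBlocks_commute_inlProj (X : Matrix (Fin p) (Fin p) ℍ[ℝ])
    (Y : Matrix (Fin q) (Fin q) ℍ[ℝ]) :
    fromBlocks X 0 0 Y * inlProj p q = inlProj p q * fromBlocks X 0 0 Y :=
  commute_inlProj_iff.2 fun _ _ => ⟨rfl, rfl⟩

theorem star_fromBlocks_of_skew {X : Matrix (Fin p) (Fin p) ℍ[ℝ]}
    {Y : Matrix (Fin q) (Fin q) ℍ[ℝ]} (hX : star X = -X) (hY : star Y = -Y) :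
    star (fromBlocks X 0 0 Y) = -fromBlocks X 0 0 Y := by
  rw [star_eq_conjTranspose, fromBlocks_conjTranspose, fromBlocks_neg, ← star_eq_conjTranspose,
    ← star_eq_conjTranspose, hX, hY]
  simp

theorem finrank_skewHerm_add_le {S : Submodule ℝ (Matrix (Fin p ⊕ Fin q) (Fin p ⊕ Fin q) ℍ[ℝ])}
    (hS : ∀ X, star X = -X → X * inlProj p q = inlProj p q * X → X ∈ S) :
    finrank ℝ (skewHerm (Fin p)) + finrank ℝ (skewHerm (Fin q)) ≤ finrank ℝ S := by
  have h1 : finrank ℝ (skewHerm (Fin p)) ≤ finrank ℝ ((skewHerm (Fin p)).map (inlEmbed p q)) :=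
    Submodule.finrank_le_of_map_le (inlEmbed p q) (fun _ h => Submodule.mem_map_of_mem h)
      fun X _ h => congrArg (blockL Sum.inl) h
  have h2 : finrank ℝ (skewHerm (Fin q)) ≤ finrank ℝ ((skewHerm (Fin q)).map (inrEmbed p q)) :=
    Submodule.finrank_le_of_map_le (inrEmbed p q) (fun _ h => Submodule.mem_map_of_mem h)
      fun X _ h => congrArg (blockL Sum.inr) h
  have h3 : (skewHerm (Fin p)).map (inlEmbed p q) ⊓ (skewHerm (Fin q)).map (inrEmbed p q) = ⊥ := by
    refine (Submodule.eq_bot_iff _).2 ?_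
    rintro _ ⟨⟨X, -, rfl⟩, Y, -, hY⟩
    have h4 : (0 : Matrix (Fin p) (Fin p) ℍ[ℝ]) = X := congrArg (blockL Sum.inl) hY
    rw [← h4, map_zero]
  have h4 : (skewHerm (Fin p)).map (inlEmbed p q) ⊔ (skewHerm (Fin q)).map (inrEmbed p q) ≤ S := by
    refine sup_le ?_ ?_
    · rintro _ ⟨X, hX, rfl⟩
      exact hS _ (star_fromBlocks_of_skew hX (by simp)) (fromBlocks_commute_inlProj _ _)
    · rintro _ ⟨X, hX, rfl⟩
      exact hS _ (star_fromBlocks_of_skew (by simp) hX) (fromBlocks_commute_inlProj _ _)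
  have h5 := Submodule.finrank_sup_add_finrank_inf_eq
    ((skewHerm (Fin p)).map (inlEmbed p q)) ((skewHerm (Fin q)).map (inrEmbed p q))
  rw [h3, finrank_bot] at h5
  have h6 := Submodule.finrank_mono h4
  omega

end SymplecticPair

section Rigidity

open Quaternion Matrix NormedSpace

set_option linter.unusedSectionVars false

attribute [local instance] Matrix.linftyOpNormedRing Matrix.linftyOpNormedAlgebra
  hasContinuousStar_matrix hasStarModule_matrix

variable {p q : ℕ}

/-- If a compact subgroup of `Sp p × Sp q` projects onto both factors on the level of Lie algebras
and its Lie algebra meets that of `Sp p`, then it has full Lie algebra. -/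
theorem mem_lie_of_exists_blockL
    {G : Set (Matrix (Fin p ⊕ Fin q) (Fin p ⊕ Fin q) ℍ[ℝ])} (hG : IsCompactUnitary G)
    (hGP : ∀ g ∈ G, g * inlProj p q = inlProj p q * g)
    (hl : ∀ X : Matrix (Fin p) (Fin p) ℍ[ℝ], star X = -X → ∃ Y ∈ hG.lie, blockL Sum.inl Y = X)
    (hr : ∀ X : Matrix (Fin q) (Fin q) ℍ[ℝ], star X = -X → ∃ Y ∈ hG.lie, blockL Sum.inr Y = X)
    (hne : hG.lie.comap (inlEmbed p q) ≠ ⊥) {X : Matrix (Fin p ⊕ Fin q) (Fin p ⊕ Fin q) ℍ[ℝ]}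
    (hX : star X = -X) (hXP : X * inlProj p q = inlProj p q * X) : X ∈ hG.lie := by
  have hskew {Y : Matrix (Fin p) (Fin p) ℍ[ℝ]} (hY : star Y = -Y) : inlEmbed p q Y ∈ hG.lie := by
    refine skew_mem_of_ideal (I := hG.lie.comap (inlEmbed p q)) (fun X hX => ?_)
      (fun Z hZ X hX => ?_) hne hY
    · have h1 : star (inlEmbed p q X) = -inlEmbed p q X := hG.star_eq_neg hX
      have h2 := congrArg (blockL Sum.inl) h1
      rwa [blockL_star, map_neg] at h2
    · obtain ⟨Y, hY, rfl⟩ := hl Z hZ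
      have h1 := hG.bracket_mem hY hX
      have h2 : Y * inlEmbed p q X - inlEmbed p q X * Y =
          inlEmbed p q (blockL Sum.inl Y * X - X * blockL Sum.inl Y) := by
        rw [eq_fromBlocks (mul_comm_of_mem_lie hG hGP hY), map_sub]
        change _ * fromBlocks X 0 0 0 - fromBlocks X 0 0 0 * _ =
          fromBlocks (_ * X) 0 0 0 - fromBlocks (X * _) 0 0 0
        rw [fromBlocks_multiply, fromBlocks_multiply]
        simp only [Matrix.mul_zero, Matrix.zero_mul, add_zero]
        rfl
      rwa [h2] at h1
  obtain ⟨Z, hZ, hZX⟩ := hr (blockL Sum.inr X) (by rw [← blockL_star, hX, map_neg])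
  have hD : star (X - Z) = -(X - Z) := by rw [star_sub, hX, hG.star_eq_neg hZ]; abel
  have hDP : (X - Z) * inlProj p q = inlProj p q * (X - Z) := by
    rw [sub_mul, mul_sub, hXP, mul_comm_of_mem_lie hG hGP hZ]
  have h1 : inlEmbed p q (blockL Sum.inl (X - Z)) ∈ hG.lie :=
    hskew (by rw [← blockL_star, hD, map_neg])
  have h2 : X - Z = inlEmbed p q (blockL Sum.inl (X - Z)) := by
    conv_lhs => rw [eq_fromBlocks hDP, map_sub (blockL Sum.inr), hZX, sub_self]
    rfl
  rw [← h2] at h1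
  simpa using Submodule.add_mem _ h1 hZ

theorem commute_lineProj_of_transfer {hqp : q ≤ p}
    {X : Matrix (Fin p ⊕ Fin q) (Fin p ⊕ Fin q) ℍ[ℝ]} (hX : star X = -X) {i : Fin q}
    (h : X * transfer hqp i = transfer hqp i * X) :
    X * lineProj (Sum.inl (Fin.castLE hqp i)) = lineProj (Sum.inl (Fin.castLE hqp i)) * X ∧
      X * lineProj (Sum.inr i) = lineProj (Sum.inr i) * X := by
  obtain ⟨h1, h2, -⟩ := commute_rk_single_iff.1 h
  have h3 {k l} (h0 : X k l = 0) : X l k = 0 := by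
    have h4 := congrFun (congrFun hX l) k
    rwa [Matrix.star_apply, h0, star_zero, Matrix.neg_apply, eq_comm, neg_eq_zero] at h4
  exact ⟨commute_rk_single_iff.2 ⟨h1, fun j hj => h3 (h1 j hj), rfl⟩,
    commute_rk_single_iff.2 ⟨fun j hj => h3 (h2 j hj), h2, rfl⟩⟩

/-- A compact subgroup of `Sp p × Sp q` whose Lie algebra is complementary, up to codimension one,
to a space of matrices commuting with the transfer maps has full Lie algebra. -/
theorem mem_lie_of_codim_le_one (hq : 5 ≤ q) (hqp : q ≤ p)
    {G : Set (Matrix (Fin p ⊕ Fin q) (Fin p ⊕ Fin q) ℍ[ℝ])} (hG : IsCompactUnitary G)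
    (hGP : ∀ g ∈ G, g * inlProj p q = inlProj p q * g)
    {D : Submodule ℝ (Matrix (Fin p ⊕ Fin q) (Fin p ⊕ Fin q) ℍ[ℝ])}
    (hDs : ∀ X ∈ D, star X = -X) (hDP : ∀ X ∈ D, X * inlProj p q = inlProj p q * X)
    (hDE : ∀ X ∈ D, ∀ i, X * transfer hqp i = transfer hqp i * X)
    {v : Matrix (Fin p ⊕ Fin q) (Fin p ⊕ Fin q) ℍ[ℝ]}
    (h : ∀ X, star X = -X → X * inlProj p q = inlProj p q * X →
      X ∈ hG.lie ⊔ D ⊔ Submodule.span ℝ {v})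
    {X : Matrix (Fin p ⊕ Fin q) (Fin p ⊕ Fin q) ℍ[ℝ]} (hX : star X = -X)
    (hXP : X * inlProj p q = inlProj p q * X) : X ∈ hG.lie := by
  have hl (X : Matrix (Fin p) (Fin p) ℍ[ℝ]) (hX : star X = -X) :
      ∃ Y ∈ hG.lie, blockL Sum.inl Y = X := by
    refine exists_mem_lie_blockL_eq hG Sum.inl_injective ?_ (by simpa using hq.trans hqp)
      (f := fun i => Fin.castLE hqp (Fin.castLE hq i)) (fun i j hij => by simpa using hij)
      (fun i j _ Y hY => ⟨hDs Y hY, (commute_lineProj_of_transfer (hDs Y hY) (hDE Y hY _)).1,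
        (commute_lineProj_of_transfer (hDs Y hY) (hDE Y hY _)).1⟩)
      (fun Z hZ => ⟨fromBlocks Z 0 0 0, h _ (star_fromBlocks_of_skew hZ (by simp))
        (fromBlocks_commute_inlProj _ _), rfl⟩) hX
    rintro g hg i (k | k) hk
    · exact (hk ⟨k, rfl⟩).elim
    · exact (commute_inlProj_iff.1 (hGP g hg) _ _).1
  have hr (X : Matrix (Fin q) (Fin q) ℍ[ℝ]) (hX : star X = -X) :
      ∃ Y ∈ hG.lie, blockL Sum.inr Y = X := by
    refine exists_mem_lie_blockL_eq hG Sum.inr_injective ?_ (by simpa using hq)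
      (f := fun i => Fin.castLE hq i) (fun i j hij => by simpa using hij)
      (fun i j _ Y hY => ⟨hDs Y hY, (commute_lineProj_of_transfer (hDs Y hY) (hDE Y hY _)).2,
        (commute_lineProj_of_transfer (hDs Y hY) (hDE Y hY _)).2⟩)
      (fun Z hZ => ⟨fromBlocks 0 0 0 Z, h _ (star_fromBlocks_of_skew (by simp) hZ)
        (fromBlocks_commute_inlProj _ _), rfl⟩) hX
    rintro g hg i (k | k) hk
    · exact (commute_inlProj_iff.1 (hGP g hg) _ _).2
    · exact (hk ⟨k, rfl⟩).elim
  refine mem_lie_of_exists_blockL hG hGP hl hr (fun hbot => ?_) hX hXP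
  have hgq : finrank ℝ hG.lie ≤ finrank ℝ (skewHerm (Fin q)) := by
    refine Submodule.finrank_le_of_map_le (blockL Sum.inr) (fun Y hY => ?_) fun Y hY hY0 => ?_
    · rw [mem_skewHerm, ← blockL_star, hG.star_eq_neg hY, map_neg]
    · have h1 : Y = inlEmbed p q (blockL Sum.inl Y) := by
        conv_lhs => rw [eq_fromBlocks (mul_comm_of_mem_lie hG hGP hY), hY0]
        rfl
      have h2 : blockL Sum.inl Y ∈ hG.lie.comap (inlEmbed p q) := by
        rwa [Submodule.mem_comap, ← h1]
      rw [hbot, Submodule.mem_bot] at h2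
      rw [h1, h2, map_zero]
  have hDW : finrank ℝ D ≤ finrank ℝ (D.map (blockL (Sum.inl : Fin p → Fin p ⊕ Fin q))) := by
    refine Submodule.finrank_le_of_map_le (blockL Sum.inl)
      (fun Y hY => Submodule.mem_map_of_mem hY) fun Y hY hY0 => ?_
    rw [eq_fromBlocks (hDP Y hY), hY0]
    have h1 : blockL Sum.inr Y = (0 : Matrix (Fin q) (Fin q) ℍ[ℝ]) := by
      ext1 i j
      obtain ⟨-, h2, h3⟩ := commute_rk_single_iff.1 (hDE Y hY i)
      by_cases hij : j = i
      · rw [hij, blockL_apply, ← h3]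
        exact congrFun (congrFun hY0 _) _
      · exact h2 _ fun h => hij (Sum.inr_injective h)
    rw [h1, fromBlocks_zero]
  have hW : finrank ℝ (D.map (blockL (Sum.inl : Fin p → Fin p ⊕ Fin q))) + 4 ≤
      finrank ℝ (skewHerm (Fin p)) := by
    have h01 : Fin.castLE hqp (Fin.castLE hq 0) ≠ Fin.castLE hqp (Fin.castLE hq 1) := by simp
    refine finrank_add_four_le h01 ?_ ?_
    · rintro _ ⟨Y, hY, rfl⟩
      rw [mem_skewHerm, ← blockL_star, hDs Y hY, map_neg]
    · rintro _ ⟨Y, hY, rfl⟩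
      have h1 := (commute_lineProj_of_transfer (hDs Y hY) (hDE Y hY (Fin.castLE hq 0))).1
      exact (blockL_mem_pairStab Sum.inl_injective ⟨hDs Y hY, h1, h1⟩).2.1
  have h1 := finrank_skewHerm_add_le h
  have h2 := Submodule.finrank_add_le_finrank_add_finrank (hG.lie ⊔ D) (Submodule.span ℝ {v})
  have h3 := Submodule.finrank_add_le_finrank_add_finrank hG.lie D
  have h4 := finrank_span_le_card (R := ℝ) ({v} : Set (Matrix (Fin p ⊕ Fin q) (Fin p ⊕ Fin q) ℍ[ℝ]))
  rw [Set.toFinset_card, Fintype.card_unique] at h4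
  omega

theorem eq_spPairSet_of_lrCohomogeneity_le_one (hq : 5 ≤ q) (hqp : q ≤ p)
    {G : Set (Matrix (Fin p ⊕ Fin q) (Fin p ⊕ Fin q) ℍ[ℝ])} (hGK : G ⊆ SpPairSet p q)
    (hgrp : IsMatSubgroup G) (hclosed : IsClosed G)
    (hcoh : lrCohomogeneity G (SpPrincipalIsotropy p q hqp) (SpPairSet p q) ≤ 1) :
    G = SpPairSet p q := by
  rw [spPairSet_eq] at hGK hcoh ⊢
  have hsub : unitaryCentralizer {inlProj p q} ⊆ SpSet _ := fun _ h => h.1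
  have hK := unitaryCentralizer_isMatSubgroup {inlProj p q}
  have hG := isCompactUnitary_of_subset_spSet hgrp (hGK.trans hsub) hclosed
  have hH := isCompactUnitary_unitaryCentralizer
    (insert (inlProj p q) (Set.range (transfer hqp)))
  obtain ⟨k, hk, v, hv⟩ := exists_mem_sup_lie_of_lrCohomogeneity_le_one hG hH hK hsub hGK
    (fun U hU => ⟨hU.1, fun P hP => hU.2 P (Or.inl hP)⟩) (spPrincipalIsotropy_subset hqp) hcoh
  have hkinv {x} (hx : star k * (k * x * star k) * k ∈ unitaryCentralizer {inlProj p q}) :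
      x ∈ unitaryCentralizer {inlProj p q} := by
    have h1 : star k * (k * x * star k) * k = x := by
      calc _ = (star k * k) * x * (star k * k) := by simp only [mul_assoc]
        _ = _ := by rw [(hsub hk).1, one_mul, mul_one]
    rwa [h1] at hx
  have hG' := isCompactUnitary_conj hG (hsub hk)
  have hGP : ∀ g ∈ {x | k * x * star k ∈ G}, g * inlProj p q = inlProj p q * g := fun g hg =>
    (hkinv (hK.2.1 _ (hK.2.1 _ (hK.2.2 _ hk) _ (hGK hg)) _ hk)).2 _ rfl
  refine hGK.antisymm fun U hU => ?_
  have hV : star k * U * k ∈ unitaryCentralizer {inlProj p q} :=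
    hK.2.1 _ (hK.2.1 _ (hK.2.2 _ hk) _ hU) _ hk
  have hmem := mem_of_forall_skew_commute_mem_lie hG' (P := inlProj p q)
    (by simp [inlProj, Matrix.star_eq_conjTranspose, Matrix.fromBlocks_conjTranspose])
    (by simp [inlProj, Matrix.fromBlocks_multiply]) hGP
    (fun X hX hXP => mem_lie_of_codim_le_one hq hqp hG' hGP (D := hH.lie)
      (fun Y hY => hH.star_eq_neg hY)
      (fun Y hY => mul_comm_of_mem_lie hH (fun g hg => hg.2 _ (Or.inl rfl)) hY)
      (fun Y hY i => mul_comm_of_mem_lie hH (fun g hg => hg.2 _ (Or.inr ⟨i, rfl⟩)) hY)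
      (fun Z hZ hZP => hv Z (exp_mem_unitaryCentralizer hZ (by simpa using hZP))) hX hXP)
    hV.1 (hV.2 _ rfl)
  have h1 : k * (star k * U * k) * star k = U := by
    calc _ = (k * star k) * U * (k * star k) := by simp only [mul_assoc]
      _ = _ := by rw [(hsub hk).2, one_mul, mul_one]
  rw [← h1]
  exact hmem

end Rigidity

theorem statement11 (p q : ℕ) (hq : 5 ≤ q) (hqp : q ≤ p)
    (G : Set (Matrix (Fin p ⊕ Fin q) (Fin p ⊕ Fin q) (Quaternion ℝ)))
    (hGK : G ⊆ SpPairSet p q) (hgrp : IsMatSubgroup G) (hclosed : IsClosed G)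
    (hconn : IsConnected G)
    (hcoh : lrCohomogeneity G (SpPrincipalIsotropy p q hqp) (SpPairSet p q) ≤ 1) :
    G = SpPairSet p q :=
  eq_spPairSet_of_lrCohomogeneity_le_one hq hqp hGK hgrp hclosed hcoh
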